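/- arXiv:math/0601151 — 3 statements merged into one kernel-verified Lean document; each statement's English description precedes it below -/
import Mathlib

section
/- Let x be a real number with x ∉ ℚ, and let y₁, …, y_k be real numbers such that 1, y₁, …, y_k are linearly independent over ℚ. Then there exist k−1 indices 1 ≤ i₁ < i₂ < ⋯ < i_{k−1} ≤ k such that the k+1 numbers 1, x, x·y_{i₁}, …, x·y_{i_{k−1}} are linearly independent over ℚ. -/
/-- If deleting any one `v p.succ` from a linearly independent family `v` leaves `z` in the span,
then `z` is a multiple of `v 0`. -/
theorem LinearIndependent.exists_smul_eq_of_forall_mem_span_succAbove {K V : Type*} [Field K]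
    [AddCommGroup V] [Module K V] {n : ℕ} {v : Fin (n + 2) → V} (hv : LinearIndependent K v)
    {z : V} (hz : ∀ p : Fin (n + 1),
      z ∈ Submodule.span K (Set.range fun j => v (p.succ.succAbove j))) :
    ∃ a : K, a • v 0 = z := by
  have key : ∀ p : Fin (n + 1), ∃ d : Fin (n + 2) → K, d p.succ = 0 ∧ ∑ i, d i • v i = z := by
    intro p
    obtain ⟨c, hc⟩ := (Submodule.mem_span_range_iff_exists_fun K).1 (hz p)
    refine ⟨p.succ.insertNth 0 c, by simp, ?_⟩
    rw [Fin.sum_univ_succAbove _ p.succ]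
    simpa using hc
  choose d hd0 hd using key
  have heq : ∀ p, d p = d 0 := fun p =>
    hv.fintypeLinearCombination_injective <| by
      simp only [Fintype.linearCombination_apply, hd]
  refine ⟨d 0 0, ?_⟩
  have hsucc : ∀ p : Fin (n + 1), d 0 p.succ = 0 := fun p => heq p ▸ hd0 p
  have h := hd 0
  rw [Fin.sum_univ_succ] at h
  simpa only [hsucc, zero_smul, Finset.sum_const_zero, add_zero] using h


/-- **Lemma (Zlobin).** If `x` is irrational and `1, y₁, …, y_k` are linearly independent
over `ℚ`, then there are `k-1` indices `i₁ < ⋯ < i_{k-1}` such that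
`1, x, x·y_{i₁}, …, x·y_{i_{k-1}}` are linearly independent over `ℚ`. -/
theorem stmt_0 (k : ℕ) (hk : 0 < k) (x : ℝ) (hx : Irrational x) (y : Fin k → ℝ)
    (hy : LinearIndependent ℚ (Fin.cons 1 y : Fin (k + 1) → ℝ)) :
    ∃ i : Fin (k - 1) → Fin k, StrictMono i ∧
      LinearIndependent ℚ
        (Fin.cons 1 (Fin.cons x (fun j => x * y (i j))) : Fin (k - 1 + 2) → ℝ) := by
  obtain ⟨n, rfl⟩ : ∃ n, k = n + 1 := ⟨k - 1, by omega⟩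
  have hv : LinearIndependent ℚ fun i => x * (Fin.cons 1 y : Fin (n + 2) → ℝ) i :=
    hy.map_injOn (LinearMap.mulLeft ℚ x) ((mul_right_injective₀ hx.ne_zero).injOn)
  obtain ⟨p, hp⟩ : ∃ p : Fin (n + 1), (1 : ℝ) ∉ Submodule.span ℚ
      (Set.range fun j => x * (Fin.cons 1 y : Fin (n + 2) → ℝ) (p.succ.succAbove j)) := by
    by_contra! h
    obtain ⟨a, ha⟩ := hv.exists_smul_eq_of_forall_mem_span_succAbove h
    simp only [Fin.cons_zero, mul_one, Rat.smul_def] at ha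
    exact hx ⟨a⁻¹, by rw [Rat.cast_inv]; exact inv_eq_of_mul_eq_one_right ha⟩
  have hfam : (Fin.cons x fun j => x * y (p.succAbove j) : Fin (n + 1) → ℝ) =
      fun j => x * (Fin.cons 1 y : Fin (n + 2) → ℝ) (p.succ.succAbove j) := by
    funext j
    cases j using Fin.cases <;> simp
  refine ⟨p.succAbove, Fin.strictMono_succAbove p, linearIndependent_finCons.2 ?_⟩
  erw [hfam]
  exact ⟨hv.comp _ Fin.succAbove_right_injective, hp⟩
end

section
/- For any positive integer l, there exists a subset S ⊆ {1, 2, …, l+1} with #S = l such that the l+2 real numbers 1, ζ(3), and ζ(3)·ζ(2k) for k ∈ S are linearly independent over ℚ. -/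
open scoped BigOperators

/-- The multiple zeta value `ζ(s₁, …, s_l) = ∑_{n₁ > n₂ > ⋯ > n_l ≥ 1} 1/(n₁^{s₁} ⋯ n_l^{s_l})`,
encoded as a tsum over strictly decreasing tuples of positive integers.
Note `mzv [] = 1` (empty product over the unique empty tuple). -/
noncomputable def mzv (s : List ℕ) : ℝ :=
  ∑' n : {n : Fin s.length → ℕ // StrictAnti n ∧ ∀ i, 0 < n i},
    ∏ i : Fin s.length, (1 : ℝ) / (n.1 i : ℝ) ^ s.get i

/-- A composition: a nonempty finite tuple of positive integers with first entry ≥ 2. -/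
def IsComposition (s : List ℕ) : Prop :=
  s ≠ [] ∧ (∀ a ∈ s, 0 < a) ∧ 2 ≤ s.headI

/-- Membership in the set `B` of nonempty vectors all of whose entries are 2 or 3. -/
def InB (s : List ℕ) : Prop :=
  s ≠ [] ∧ ∀ a ∈ s, a = 2 ∨ a = 3

section

open Finset Filter Topology

/-- The product `C(n,k) C(n+k,k)` as a real number. -/
noncomputable def aperyU (n k : ℕ) : ℝ := (n.choose k : ℝ) * ((n + k).choose k : ℝ)

theorem aperyU_eq_zero {n k : ℕ} (h : n < k) : aperyU n k = 0 := by
  simp [aperyU, Nat.choose_eq_zero_of_lt h]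

theorem aperyU_pos {n k : ℕ} (h : k ≤ n) : 0 < aperyU n k := by
  have h1 := Nat.choose_pos h
  have h2 := Nat.choose_pos (show k ≤ n + k by lia)
  unfold aperyU
  positivity

theorem aperyU_zero_right (n : ℕ) : aperyU n 0 = 1 := by simp [aperyU]

theorem aperyU_succ_left (n k : ℕ) :
    ((n : ℝ) + 1 - k) * aperyU (n + 1) k = (n + 1 + k) * aperyU n k := by
  rcases lt_trichotomy k (n + 1) with h | rfl | h
  · have h1 : ((n + 1).choose k : ℝ) * (n + 1 - k) = n.choose k * (n + 1) := by
      have := Nat.choose_mul_succ_eq n k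
      have h3 : ((n + 1 - k : ℕ) : ℝ) = n + 1 - k := by
        rw [Nat.cast_sub h.le]; push_cast; ring
      rw [← h3]
      exact_mod_cast this.symm
    have h2 : ((n + 1 + k).choose k : ℝ) * (n + 1) = (n + k).choose k * (n + 1 + k) := by
      have := Nat.choose_mul_succ_eq (n + k) k
      have h3 : n + k + 1 - k = n + 1 := by lia
      rw [h3, show n + k + 1 = n + 1 + k by ring] at this
      exact_mod_cast this.symm
    have hn : (n : ℝ) + 1 ≠ 0 := by positivity
    unfold aperyU
    apply mul_left_cancel₀ hn
    linear_combination (n + 1) * ((n + 1 + k).choose k : ℝ) * h1 +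
      (n.choose k : ℝ) * (n + 1) * h2
  · simp [aperyU_eq_zero]
  · rw [aperyU_eq_zero h, aperyU_eq_zero (by lia : n < k)]; simp

theorem aperyU_succ_right (n k : ℕ) :
    ((k : ℝ) + 1) ^ 2 * aperyU n (k + 1) = (n + k + 1) * (n - k) * aperyU n k := by
  have h1 : (n.choose (k + 1) : ℝ) * (k + 1) = n.choose k * (n - k) := by
    rcases le_or_gt k n with h | h
    · have := Nat.choose_succ_right_eq n k
      rw [← Nat.cast_sub h]
      exact_mod_cast this
    · simp [Nat.choose_eq_zero_of_lt h, Nat.choose_eq_zero_of_lt (by lia : n < k + 1)]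
  have h2 : ((n + (k + 1)).choose (k + 1) : ℝ) * (k + 1) = (n + k).choose k * (n + k + 1) := by
    have := Nat.add_one_mul_choose_eq (n + k) k
    rw [mul_comm] at this
    rw [← add_assoc]
    exact_mod_cast this.symm
  unfold aperyU
  linear_combination (((n + (k + 1)).choose (k + 1) : ℝ) * (k + 1)) * h1 +
      (n.choose k : ℝ) * (n - k) * h2

/-- A common factor of neighbouring values of `aperyU`. -/
theorem exists_aperyU_factor {n k : ℕ} (h : k ≤ n + 1) : ∃ w : ℝ, w ≠ 0 ∧
    aperyU n (k + 1) = w * (n + 1 - k) * (n - k) ∧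
    aperyU (n + 1) (k + 1) = w * (n + 2 + k) * (n + 1 - k) ∧
    aperyU (n + 2) (k + 1) = w * (n + 2 + k) * (n + 3 + k) ∧
    aperyU (n + 1) k = w * (k + 1) ^ 2 := by
  have hk : (0 : ℝ) < (k + 1) ^ 2 := by positivity
  have h0 := aperyU_pos h
  refine ⟨aperyU (n + 1) k / (k + 1) ^ 2, by positivity, ?_, ?_, ?_, by field_simp⟩
  all_goals
    have e1 := aperyU_succ_left n k
    have e2 := aperyU_succ_left (n + 1) k
    have e3 := aperyU_succ_right n k
    have e4 := aperyU_succ_right (n + 1) k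
    have e5 := aperyU_succ_right (n + 2) k
    push_cast at *
    field_simp
  · have : ((n : ℝ) + 1 + k) ≠ 0 := by positivity
    apply mul_left_cancel₀ this
    linear_combination (n + 1 + k : ℝ) * e3 - (n + k + 1) * (n - k) * e1
  · linear_combination e4
  · linear_combination e5 + (n + 2 + k + 1 : ℝ) * e2

noncomputable def aperyC (n k : ℕ) : ℝ :=
  ∑ m ∈ range n, 1 / ((m : ℝ) + 1) ^ 3 +
    ∑ m ∈ range k, (-1) ^ m / (2 * ((m : ℝ) + 1) ^ 3 * aperyU n (m + 1))

theorem aperyC_succ_right (n k : ℕ) : aperyC n (k + 1) =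
    aperyC n k + (-1) ^ k / (2 * ((k : ℝ) + 1) ^ 3 * aperyU n (k + 1)) := by
  simp [aperyC, sum_range_succ, add_assoc]

theorem aperyC_succ_left {n k : ℕ} (h : k ≤ n) : aperyC (n + 1) k =
    aperyC n k + (-1) ^ k / (((n : ℝ) + 1) ^ 2 * (n + 1 + k) * aperyU n k) := by
  induction k with
  | zero => 
    simp [aperyC, sum_range_succ, aperyU_zero_right]; field_simp
  | succ k ih =>
    rw [aperyC_succ_right, aperyC_succ_right, ih (by lia)]
    have e1 := aperyU_succ_right n k
    have e2 := aperyU_succ_right (n + 1) k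
    have e3 := aperyU_succ_left n k
    have p1 := aperyU_pos (show k ≤ n by lia)
    have p2 := aperyU_pos h
    have p3 := aperyU_pos (show k + 1 ≤ n + 1 by lia)
    have hk : (n : ℝ) - k ≠ 0 := by
      have : (k : ℝ) + 1 ≤ n := by exact_mod_cast h
      linarith
    have hk' : (n : ℝ) + 1 - k ≠ 0 := by
      have : (k : ℝ) + 1 ≤ n := by exact_mod_cast h
      linarith
    have hk1 : (k : ℝ) + 1 ≠ 0 := by positivity
    have f1 : aperyU n (k + 1) = (n + k + 1) * (n - k) * aperyU n k / (k + 1) ^ 2 := by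
      field_simp; linear_combination e1
    have f3 : aperyU (n + 1) k = (n + 1 + k) * aperyU n k / (n + 1 - k) := by
      field_simp; linear_combination e3
    have f2 : aperyU (n + 1) (k + 1) = (n + k + 2) * (n + 1 + k) * aperyU n k / (k + 1) ^ 2 := by
      field_simp
      rw [f3] at e2
      push_cast at e2
      field_simp at e2
      linear_combination e2
    rw [f1, f2, pow_succ]
    push_cast
    have q1 : (n : ℝ) + k + 1 ≠ 0 := by positivity
    have q2 : (n : ℝ) + k + 2 ≠ 0 := by positivity
    have q3 : (n : ℝ) + 1 + k ≠ 0 := by positivity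
    have q4 : (n : ℝ) + 1 + (k + 1) ≠ 0 := by positivity
    field_simp
    ring

noncomputable def aperyA (n : ℕ) : ℝ := ∑ k ∈ range (n + 1), aperyU n k ^ 2

noncomputable def aperyB (n : ℕ) : ℝ := ∑ k ∈ range (n + 1), aperyU n k ^ 2 * aperyC n k

theorem aperyA_eq {n m : ℕ} (h : n < m) : aperyA n = ∑ k ∈ range m, aperyU n k ^ 2 := by
  refine sum_subset (by simpa using h) fun k _ hk => ?_
  rw [aperyU_eq_zero (by simpa using hk)]; simp

theorem aperyB_eq {n m : ℕ} (h : n < m) :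
    aperyB n = ∑ k ∈ range m, aperyU n k ^ 2 * aperyC n k := by
  refine sum_subset (by simpa using h) fun k _ hk => ?_
  rw [aperyU_eq_zero (by simpa using hk)]; simp

/-- Zeilberger's certificate for the numbers `aperyA`. -/
noncomputable def aperyCertA (n k : ℕ) : ℝ :=
  4 * (2 * n + 3) * (k * (2 * k + 1) - (2 * n + 3) ^ 2) * aperyU (n + 1) k ^ 2

theorem aperyA_rec (n : ℕ) :
    ((n : ℝ) + 2) ^ 3 * aperyA (n + 2) =
      (34 * (n + 1) ^ 3 + 51 * (n + 1) ^ 2 + 27 * (n + 1) + 5) * aperyA (n + 1)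
        - (n + 1) ^ 3 * aperyA n := by
  rw [aperyA_eq (show n < n + 3 by lia), aperyA_eq (show n + 1 < n + 3 by lia), aperyA,
    ← sub_eq_zero, mul_sum, mul_sum, mul_sum, ← sum_sub_distrib, ← sum_sub_distrib]
  have key : ∀ m ≤ n + 3, ∑ k ∈ range m, (((n : ℝ) + 2) ^ 3 * aperyU (n + 2) k ^ 2 -
      ((34 * (n + 1) ^ 3 + 51 * (n + 1) ^ 2 + 27 * (n + 1) + 5) * aperyU (n + 1) k ^ 2 -
        (n + 1) ^ 3 * aperyU n k ^ 2)) = if m = 0 then 0 else aperyCertA n (m - 1) := by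
    intro m hm
    induction m with
    | zero => simp
    | succ k ih =>
      rw [sum_range_succ, ih (by lia)]
      rcases k with _ | k
      · simp [aperyCertA, aperyU_zero_right]; ring
      · obtain ⟨w, -, h1, h2, h3, h4⟩ := exists_aperyU_factor (show k ≤ n + 1 by lia)
        simp only [aperyCertA, Nat.add_eq_zero_iff, one_ne_zero, and_false, if_false,
          Nat.add_sub_cancel]
        rw [h1, h2, h3, h4]
        push_cast
        ring
  rw [key _ le_rfl]
  simp [aperyCertA, aperyU_eq_zero]

noncomputable def aperyCertB (n k : ℕ) : ℝ :=
  aperyCertA n k * aperyC (n + 1) k -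
    5 * (2 * n + 3) * (-1) ^ k * k / ((n + 1) * (n + 2)) * aperyU (n + 1) k

theorem aperyB_rec (n : ℕ) :
    ((n : ℝ) + 2) ^ 3 * aperyB (n + 2) =
      (34 * (n + 1) ^ 3 + 51 * (n + 1) ^ 2 + 27 * (n + 1) + 5) * aperyB (n + 1)
        - (n + 1) ^ 3 * aperyB n := by
  rw [aperyB_eq (show n < n + 3 by lia), aperyB_eq (show n + 1 < n + 3 by lia), aperyB,
    ← sub_eq_zero, mul_sum, mul_sum, mul_sum, ← sum_sub_distrib, ← sum_sub_distrib]
  have key : ∀ m ≤ n + 3, ∑ k ∈ range m, (((n : ℝ) + 2) ^ 3 * (aperyU (n + 2) k ^ 2 *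
      aperyC (n + 2) k) -
      ((34 * (n + 1) ^ 3 + 51 * (n + 1) ^ 2 + 27 * (n + 1) + 5) * (aperyU (n + 1) k ^ 2 *
        aperyC (n + 1) k) -
        (n + 1) ^ 3 * (aperyU n k ^ 2 * aperyC n k))) =
      if m = 0 then 0 else aperyCertB n (m - 1) := by
    intro m hm
    induction m with
    | zero => simp
    | succ k ih =>
      have d1 : aperyU (n + 1) k ^ 2 * aperyC (n + 1) k = aperyU (n + 1) k ^ 2 * aperyC (n + 2) k -
          aperyU (n + 1) k * ((-1) ^ k / (((n : ℝ) + 2) ^ 2 * (n + 2 + k))) := by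
        rcases le_or_gt k (n + 1) with h | h
        · have := aperyU_pos h
          rw [aperyC_succ_left h]
          push_cast
          have q1 : (n : ℝ) + 1 + 1 + k ≠ 0 := by positivity
          have q2 : (n : ℝ) + 2 + k ≠ 0 := by positivity
          have q3 : (n : ℝ) + 1 + 1 ≠ 0 := by positivity
          field_simp
          ring
        · simp [aperyU_eq_zero h]
      have d2 : aperyU n k ^ 2 * aperyC n k = aperyU n k ^ 2 * aperyC (n + 2) k -
          aperyU n k * ((-1) ^ k / (((n : ℝ) + 1) ^ 2 * (n + 1 + k))) -
          aperyU n k * (n + 1 - k) * ((-1) ^ k / (((n : ℝ) + 2) ^ 2 * (n + 2 + k) * (n + 1 + k)))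
          := by
        rcases le_or_gt k n with h | h
        · have p1 := aperyU_pos h
          have p2 := aperyU_pos (show k ≤ n + 1 by lia)
          rw [aperyC_succ_left (show k ≤ n + 1 by lia), aperyC_succ_left h]
          have e := aperyU_succ_left n k
          have hk' : (n : ℝ) + 1 - k ≠ 0 := by
            have : (k : ℝ) ≤ n := by exact_mod_cast h
            linarith
          have f3 : aperyU (n + 1) k = (n + 1 + k) * aperyU n k / (n + 1 - k) := by
            field_simp; linear_combination e
          rw [f3]
          push_cast
          have q1 : (n : ℝ) + 1 + 1 + k ≠ 0 := by positivity
          have q2 : (n : ℝ) + 2 + k ≠ 0 := by positivity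
          have q3 : (n : ℝ) + 1 + 1 ≠ 0 := by positivity
          have q4 : (n : ℝ) + 1 + k ≠ 0 := by positivity
          field_simp
          ring
        · simp [aperyU_eq_zero h]
      rw [sum_range_succ, ih (by lia), d1, d2]
      rcases k with _ | k
      · have := d1
        simp only [aperyU_zero_right, one_pow, one_mul, pow_zero, CharP.cast_eq_zero] at this
        simp [aperyCertA, aperyCertB, aperyU_zero_right]
        rw [this]
        field_simp
        ring
      · obtain ⟨w, hw, h1, h2, h3, h4⟩ := exists_aperyU_factor (show k ≤ n + 1 by lia)
        have d3 := aperyC_succ_right (n + 2) k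
        have d4 := aperyC_succ_left (show k ≤ n + 1 by lia)
        have d5 : aperyC (n + 1) k = aperyC (n + 2) (k + 1) -
          (-1) ^ k / (2 * ((k : ℝ) + 1) ^ 3 * aperyU (n + 2) (k + 1)) -
          (-1) ^ k / (((n : ℝ) + 2) ^ 2 * (n + 2 + k) * aperyU (n + 1) k) := by
          rw [d3, d4]; push_cast; ring
        have hC : aperyCertB n (k + 1) = 4 * (2 * n + 3) * ((k + 1 : ℕ) * (2 * (k + 1 : ℕ) + 1)
            - (2 * n + 3) ^ 2) * (aperyU (n + 1) (k + 1) ^ 2 * aperyC (n + 1) (k + 1)) -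
            5 * (2 * n + 3) * (-1) ^ (k + 1) * (k + 1 : ℕ) / ((n + 1) * (n + 2))
              * aperyU (n + 1) (k + 1) := by
          simp only [aperyCertA, aperyCertB]; ring
        simp only [Nat.add_eq_zero_iff, one_ne_zero, and_false, if_false,
          Nat.add_sub_cancel]
        rw [hC, d1]
        simp only [aperyCertA, aperyCertB]
        rw [d5, h1, h2, h3, h4, pow_succ (-1 : ℝ) k]
        generalize aperyC (n + 2) (k + 1) = c
        generalize (-1 : ℝ) ^ k = s
        push_cast
        have q2 : (n : ℝ) + 2 + k ≠ 0 := by positivity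
        have q3 : (n : ℝ) + 3 + k ≠ 0 := by positivity
        have q4 : (n : ℝ) + 2 + (k + 1) ≠ 0 := by positivity
        have q5 : (n : ℝ) + 1 + (k + 1) ≠ 0 := by positivity
        have q6 : (k : ℝ) + 1 ≠ 0 := by positivity
        rw [show (n : ℝ) + 2 + (k + 1) = n + 3 + k by ring,
          show (n : ℝ) + 1 + (k + 1) = n + 2 + k by ring]
        field_simp
        ring
  rw [key _ le_rfl]
  simp [aperyCertB, aperyCertA, aperyU_eq_zero]

theorem one_le_aperyA (n : ℕ) : 1 ≤ aperyA n := by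
  have := single_le_sum (f := fun k => aperyU n k ^ 2) (fun k _ => sq_nonneg _)
    (mem_range.2 (Nat.succ_pos n))
  unfold aperyA
  simpa [aperyU_zero_right] using this

theorem aperyA_le_succ (n : ℕ) : aperyA n ≤ aperyA (n + 1) := by
  rw [aperyA_eq (show n < n + 1 + 1 by lia), aperyA]
  gcongr with k
  · unfold aperyU; positivity
  · unfold aperyU; gcongr <;> lia

theorem aperyA_casoratian (n : ℕ) :
    aperyB (n + 1) * aperyA n - aperyA (n + 1) * aperyB n = 6 / ((n : ℝ) + 1) ^ 3 := by
  induction n with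
  | zero => simp [aperyA, aperyB, aperyC, aperyU, sum_range_succ]; norm_num
  | succ n ih =>
    have h1 := aperyA_rec n
    have h2 := aperyB_rec n
    push_cast
    have h3 : (n : ℝ) + 1 + 1 ≠ 0 := by positivity
    field_simp at ih ⊢
    rw [← ih]
    rw [show n + 1 + 1 = n + 2 by ring]
    linear_combination aperyA (n + 1) * h2 - aperyB (n + 1) * h1

theorem aperyA_growth {n : ℕ} (h : 20 ≤ n) : 30 * aperyA (n + 1) ≤ aperyA (n + 2) := by
  have h1 := aperyA_rec n
  have h2 := aperyA_le_succ n
  have h3 := one_le_aperyA (n + 1)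
  have h4 : (20 : ℝ) ≤ n := by exact_mod_cast h
  have h5 : (0 : ℝ) < (n + 2) ^ 3 := by positivity
  refine le_of_mul_le_mul_left ?_ h5
  rw [h1]
  have h6 : ((n : ℝ) + 1) ^ 3 * aperyA n ≤ (n + 1) ^ 3 * aperyA (n + 1) := by gcongr
  have h7 : 0 ≤ 3 * ((n : ℝ) + 1) ^ 3 - 39 * (n + 1) ^ 2 - 63 * (n + 1) - 25 := by
    obtain ⟨x, hx⟩ : ∃ x : ℝ, x = n - 20 := ⟨_, rfl⟩
    have hx0 : 0 ≤ x := by linarith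
    rw [show (n : ℝ) = x + 20 by linarith]
    ring_nf
    positivity
  nlinarith

theorem pow_le_aperyA (n : ℕ) : (30 : ℝ) ^ n ≤ aperyA (n + 21) := by
  induction n with
  | zero => simpa using one_le_aperyA 21
  | succ n ih =>
    have := aperyA_growth (show 20 ≤ n + 20 by lia)
    rw [pow_succ]
    calc _ ≤ 30 * aperyA (n + 21) := by linarith
      _ ≤ _ := this

theorem succ_le_aperyU {n k : ℕ} (h : k < n) : (n : ℝ) + 1 ≤ aperyU n (k + 1) := by
  have h1 := Nat.choose_pos h
  have h2 : n + 1 ≤ (n + (k + 1)).choose (k + 1) := by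
    rw [← Nat.choose_symm_add]
    calc n + 1 = (n + 1).choose n := by simp
      _ ≤ _ := Nat.choose_le_choose n (by lia)
  have h3 : (1 : ℝ) ≤ n.choose (k + 1) := by exact_mod_cast h1
  have h4 : (n : ℝ) + 1 ≤ (n + (k + 1)).choose (k + 1) := by exact_mod_cast h2
  unfold aperyU
  nlinarith

theorem summable_inv_succ_cube : Summable fun m : ℕ => 1 / ((m : ℝ) + 1) ^ 3 := by
  have := (summable_nat_add_iff 1).2 (Real.summable_one_div_nat_pow.2 (show 1 < 3 by norm_num))
  simpa using this

theorem abs_aperyB_sub_le (n : ℕ) :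
    |aperyB n - aperyA n * ∑ m ∈ range n, 1 / ((m : ℝ) + 1) ^ 3| ≤
      aperyA n * ((∑' m : ℕ, 1 / ((m : ℝ) + 1) ^ 3) / (n + 1)) := by
  rw [aperyB, aperyA, sum_mul, sum_mul, ← sum_sub_distrib]
  refine (abs_sum_le_sum_abs _ _).trans (sum_le_sum fun k hk => ?_)
  rw [← mul_sub, abs_mul, abs_of_nonneg (sq_nonneg _)]
  gcongr
  rw [aperyC, add_sub_cancel_left]
  refine (abs_sum_le_sum_abs _ _).trans ?_
  calc _ ≤ ∑ m ∈ range k, 1 / ((m : ℝ) + 1) ^ 3 / ((n : ℝ) + 1) := by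
        refine sum_le_sum fun m hm => ?_
        have h1 := succ_le_aperyU (show m < n by simp at hk hm; lia)
        have h2 : (0 : ℝ) < aperyU n (m + 1) := lt_of_lt_of_le (by positivity) h1
        rw [abs_div, abs_pow, abs_neg, abs_one, one_pow, abs_of_pos (by positivity), div_div]
        gcongr
        have : (0 : ℝ) < (m + 1) ^ 3 := by positivity
        linarith
    _ = (∑ m ∈ range k, 1 / ((m : ℝ) + 1) ^ 3) / ((n : ℝ) + 1) := by rw [sum_div]
    _ ≤ _ := by
      gcongr
      exact summable_inv_succ_cube.sum_le_tsum _ fun _ _ => by positivity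

theorem tendsto_aperyB_div : Tendsto (fun n => aperyB n / aperyA n) atTop
    (𝓝 (∑' m : ℕ, 1 / ((m : ℝ) + 1) ^ 3)) := by
  have h1 := summable_inv_succ_cube.hasSum.tendsto_sum_nat
  have h2 : Tendsto (fun n : ℕ => aperyB n / aperyA n - ∑ m ∈ range n, 1 / ((m : ℝ) + 1) ^ 3)
      atTop (𝓝 0) := by
    refine squeeze_zero_norm (a := fun n : ℕ => (∑' m : ℕ, 1 / ((m : ℝ) + 1) ^ 3) * (1 / ((n : ℝ) + 1)))
      (fun n => ?_) ?_
    · have ha := one_le_aperyA n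
      have hb := abs_aperyB_sub_le n
      have ha' : 0 < aperyA n := by linarith
      rw [Real.norm_eq_abs, div_sub' ha'.ne', abs_div, abs_of_pos ha', div_le_iff₀ ha']
      rw [mul_one_div]
      linarith
    · have := (tendsto_one_div_add_atTop_nhds_zero_nat (𝕜 := ℝ)).const_mul
        (∑' m : ℕ, 1 / ((m : ℝ) + 1) ^ 3)
      rwa [mul_zero] at this
  simpa using h2.add h1

theorem aperyA_mul_sub_bounds (n : ℕ) :
    0 < aperyA (n + 21) * ∑' m : ℕ, 1 / ((m : ℝ) + 1) ^ 3 - aperyB (n + 21) ∧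
    aperyA (n + 21) * ∑' m : ℕ, 1 / ((m : ℝ) + 1) ^ 3 - aperyB (n + 21) ≤ 4 / 30 ^ n := by
  set Z := ∑' m : ℕ, 1 / ((m : ℝ) + 1) ^ 3
  have hpos (n) : 0 < aperyA n := by linarith [one_le_aperyA n]
  set x : ℕ → ℝ := fun n => Z - aperyB n / aperyA n with hx
  have hx0 : Tendsto x atTop (𝓝 0) := by
    have := tendsto_aperyB_div.const_sub Z
    rwa [sub_self] at this
  have hd (n) : x n - x (n + 1) = 6 / ((n + 1) ^ 3 * (aperyA n * aperyA (n + 1))) := by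
    have h := aperyA_casoratian n
    have h1 := hpos n
    have h2 := hpos (n + 1)
    simp only [hx]
    field_simp at h ⊢
    linear_combination h
  have hanti : StrictAnti x := strictAnti_nat_of_succ_lt fun n => by
    have := hd n
    have h1 := hpos n
    have h2 := hpos (n + 1)
    have : 0 < x n - x (n + 1) := by rw [this]; positivity
    linarith
  have hxpos (n) : 0 < x n := (hanti.antitone.le_of_tendsto hx0 (n + 1)).trans_lt
    (hanti (Nat.lt_succ_self n))
  have hy : Monotone fun n => x (n + 21) - 4 / aperyA (n + 21) ^ 2 :=
    monotone_nat_of_le_succ fun n => by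
      have h := hd (n + 21)
      have h1 := hpos (n + 21)
      have h2 := hpos (n + 22)
      have h3 := aperyA_growth (show 20 ≤ n + 20 by lia)
      simp only [show n + 20 + 1 = n + 21 by rfl, show n + 20 + 2 = n + 22 by rfl] at h h3
      rw [show n + 1 + 21 = n + 22 by lia]
      generalize aperyA (n + 21) = s at *
      generalize aperyA (n + 22) = t at *
      have e1 : 6 / ((((n + 21 : ℕ) : ℝ) + 1) ^ 3 * (s * t)) ≤ 6 / (1 * (s * (2 * s))) := by
        gcongr
        · exact one_le_pow₀ (by linarith [Nat.cast_nonneg (α := ℝ) (n + 21)])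
        · linarith
      have e2 : 4 / t ^ 2 ≤ 4 / (2 * s) ^ 2 := by
        gcongr; linarith
      have e3 : 6 / (1 * (s * (2 * s))) = 3 / s ^ 2 := by field_simp; norm_num
      have e4 : 4 / (2 * s) ^ 2 = 1 / s ^ 2 := by field_simp; norm_num
      have e5 : 4 / s ^ 2 = 3 / s ^ 2 + 1 / s ^ 2 := by ring
      linarith
  have hinv : Tendsto (fun n => 4 / aperyA (n + 21) ^ 2) atTop (𝓝 0) := by
    have h30 : Tendsto (fun n : ℕ => 4 * ((1 : ℝ) / 30) ^ n) atTop (𝓝 0) := by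
      simpa using (tendsto_pow_atTop_nhds_zero_of_lt_one (r := (1 : ℝ) / 30) (by norm_num)
        (by norm_num)).const_mul 4
    refine squeeze_zero (fun n => by positivity) (fun n => ?_) h30
    have h1 := pow_le_aperyA n
    have h2 := one_le_aperyA (n + 21)
    rw [one_div, inv_pow, ← div_eq_mul_inv]
    gcongr
    nlinarith
  have hy0 : Tendsto (fun n => x (n + 21) - 4 / aperyA (n + 21) ^ 2) atTop (𝓝 0) := by
    simpa using ((tendsto_add_atTop_iff_nat 21).2 hx0).sub hinv
  have hle := hy.ge_of_tendsto hy0 n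
  have h1 := hpos (n + 21)
  have e : aperyA (n + 21) * Z - aperyB (n + 21) = aperyA (n + 21) * x (n + 21) := by
    simp only [hx]; field_simp
  rw [e]
  refine ⟨mul_pos h1 (hxpos _), ?_⟩
  calc aperyA (n + 21) * x (n + 21) ≤ aperyA (n + 21) * (4 / aperyA (n + 21) ^ 2) := by
        gcongr; linarith
    _ = 4 / aperyA (n + 21) := by field_simp
    _ ≤ _ := by gcongr; exact pow_le_aperyA n

theorem succ_mul_choose_dvd {D : ℕ} (j : ℕ) : ∀ n, j ≤ n → (∀ i ≤ n, i + 1 ∣ D) →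
    (n + 1) * n.choose j ∣ D := by
  induction j with
  | zero => intro n _ h; simpa using h n le_rfl
  | succ j ih =>
    rintro (_ | n) hn h
    · simp at hn
    obtain ⟨y, hy⟩ := ih n (by lia) fun i hi => h i (by lia)
    obtain ⟨z, hz⟩ := ih (n + 1) (by lia) h
    have h1 := Nat.add_one_mul_choose_eq n j
    have h2 := Nat.choose_mul_succ_eq n j
    have h3 : n + 1 - j + j = n + 1 := by lia
    zify at *
    refine ⟨(y - z : ℤ), mul_left_cancel₀ (show (j : ℤ) + 1 ≠ 0 by positivity) ?_⟩
    linear_combination (n + 2) * hy - ((n + 1 - j : ℕ) : ℤ) * hz + (D : ℤ) * h3 +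
      ((n : ℤ) + 2) * (y - z) * h1 + ((n : ℤ) + 2) * z * h2

theorem mul_choose_dvd_lcmUpto {n m j : ℕ} (hj : 0 < j) (hm : j ≤ m) (hmn : m ≤ n) :
    j * m.choose j ∣ n.lcmUpto := by
  obtain ⟨m, rfl⟩ : ∃ m', m = m' + 1 := ⟨m - 1, by lia⟩
  obtain ⟨j, rfl⟩ : ∃ j', j = j' + 1 := ⟨j - 1, by lia⟩
  rw [mul_comm, ← Nat.add_one_mul_choose_eq]
  refine succ_mul_choose_dvd j m (by lia) fun i hi => ?_
  exact Finset.dvd_lcm (f := id) (mem_Icc.2 ⟨by lia, by lia⟩)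

theorem exists_int_lcmUpto_mul_term {n k j : ℕ} (hj : 0 < j) (hjk : j ≤ k) (hk : k ≤ n) :
    ∃ z : ℤ, (n.lcmUpto : ℝ) ^ 3 * (aperyU n k ^ 2 / ((j : ℝ) ^ 3 * aperyU n j)) = z := by
  obtain ⟨x, hx⟩ := mul_choose_dvd_lcmUpto hj le_rfl (hjk.trans hk)
  obtain ⟨y, hy⟩ := mul_choose_dvd_lcmUpto hj (hjk.trans hk) le_rfl
  obtain ⟨z, hz⟩ := mul_choose_dvd_lcmUpto hj hjk hk
  have h := Nat.choose_mul (n := n + k) (k := k) (s := k - j) (by lia)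
  rw [show n + k - (k - j) = n + j by lia, show k - (k - j) = j by lia,
    Nat.choose_symm hjk] at h
  have p1 : (0 : ℝ) < n.choose j := by exact_mod_cast Nat.choose_pos (hjk.trans hk)
  have p2 : (0 : ℝ) < k.choose j := by exact_mod_cast Nat.choose_pos hjk
  have p3 : (0 : ℝ) < (n + j).choose j := by exact_mod_cast Nat.choose_pos (by lia)
  have pj : (0 : ℝ) < j := by exact_mod_cast hj
  refine ⟨x * y * z * (n + k).choose (k - j) * n.choose k ^ 2 * (n + k).choose k, ?_⟩
  rw [Nat.choose_self, mul_one] at hx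
  have hx' : (n.lcmUpto : ℝ) = j * x := by exact_mod_cast hx
  have hy' : (n.lcmUpto : ℝ) = j * n.choose j * y := by exact_mod_cast hy
  have hz' : (n.lcmUpto : ℝ) = j * k.choose j * z := by exact_mod_cast hz
  have h' : ((n + k).choose k : ℝ) * k.choose j = (n + k).choose (k - j) * (n + j).choose j := by
    exact_mod_cast h
  unfold aperyU
  have e : (n.lcmUpto : ℝ) ^ 3 = (j * x) * (j * n.choose j * y) * (j * k.choose j * z) := by
    rw [← hx', ← hy', ← hz']; ring
  rw [e]
  push_cast
  field_simp
  linear_combination x * y * z * (n.choose k : ℝ) ^ 2 * (n + k).choose k * h'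

theorem exists_int_aperyA (n : ℕ) : ∃ z : ℤ, aperyA n = z :=
  ⟨∑ k ∈ range (n + 1), (n.choose k * (n + k).choose k : ℤ) ^ 2, by simp [aperyA, aperyU]⟩

theorem exists_int_aperyB (n : ℕ) : ∃ z : ℤ, 2 * (n.lcmUpto : ℝ) ^ 3 * aperyB n = z := by
  have hsum {s : Finset ℕ} {f : ℕ → ℝ} (h : ∀ i ∈ s, ∃ z : ℤ, f i = z) :
      ∃ z : ℤ, ∑ i ∈ s, f i = z := by
    choose! g hg using h
    exact ⟨∑ i ∈ s, g i, by rw [Int.cast_sum]; exact sum_congr rfl hg⟩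
  rw [aperyB, mul_sum]
  refine hsum fun k hk => ?_
  have hk : k ≤ n := by simp at hk; lia
  obtain ⟨y, hy⟩ : ∃ z : ℤ, ∑ m ∈ range n, (n.lcmUpto : ℝ) ^ 3 * (1 / ((m : ℝ) + 1) ^ 3) = (z : ℝ) := by
    refine hsum fun m hm => ?_
    obtain ⟨z, hz⟩ : m + 1 ∣ n.lcmUpto :=
      Finset.dvd_lcm (f := id) (mem_Icc.2 ⟨by lia, by simp at hm; lia⟩)
    refine ⟨z ^ 3, ?_⟩
    rw [hz]
    push_cast
    field_simp
  obtain ⟨z, hz⟩ : ∃ z : ℤ, ∑ m ∈ range k, (n.lcmUpto : ℝ) ^ 3 *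
      ((-1) ^ m * (aperyU n k ^ 2 / (((m + 1 : ℕ) : ℝ) ^ 3 * aperyU n (m + 1)))) = (z : ℝ) := by
    refine hsum fun m hm => ?_
    obtain ⟨z, hz⟩ := exists_int_lcmUpto_mul_term (Nat.succ_pos m)
      (show m + 1 ≤ k by simp at hm; lia) hk
    refine ⟨(-1) ^ m * z, ?_⟩
    push_cast at hz ⊢
    rw [← hz]
    ring
  refine ⟨2 * y * (n.choose k * (n + k).choose k) ^ 2 + z, ?_⟩
  push_cast
  rw [← hy, ← hz, aperyC, ← mul_sum, mul_add, mul_add, mul_sum (range k), mul_sum (range k)]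
  congr 1
  · rw [aperyU]; ring
  · refine sum_congr rfl fun m hm => ?_
    push_cast
    have : aperyU n (m + 1) ≠ 0 := (aperyU_pos (by simp at hm; lia)).ne'
    field_simp

theorem irrational_tsum_inv_cube
    (hd : Tendsto (fun n : ℕ => (n.lcmUpto : ℝ) ^ 3 / 30 ^ n) atTop (𝓝 0)) :
    Irrational (∑' m : ℕ, 1 / ((m : ℝ) + 1) ^ 3) := by
  rintro ⟨r, hr⟩
  have hq : (0 : ℝ) < r.den := by exact_mod_cast r.den_pos
  have hr' : (∑' m : ℕ, 1 / ((m : ℝ) + 1) ^ 3) * r.den = (r.num : ℝ) := by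
    rw [← hr]; exact_mod_cast r.mul_den_eq_num
  have hc : (0 : ℝ) < 1 / (r.den * 8 * 30 ^ 21) := by positivity
  obtain ⟨N, hN⟩ := eventually_atTop.1 (hd.eventually (gt_mem_nhds hc))
  have h := hN (N + 21) (by lia)
  obtain ⟨h1, h2⟩ := aperyA_mul_sub_bounds N
  obtain ⟨a, ha⟩ := exists_int_aperyA (N + 21)
  obtain ⟨b, hb⟩ := exists_int_aperyB (N + 21)
  set Z := ∑' m : ℕ, 1 / ((m : ℝ) + 1) ^ 3
  set L := (N + 21).lcmUpto
  have hL : (0 : ℝ) < L := by exact_mod_cast Nat.lcmUpto_pos _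
  have e : r.den * 2 * (L : ℝ) ^ 3 * (aperyA (N + 21) * Z - aperyB (N + 21)) =
      ((2 * L ^ 3 * a * r.num - r.den * b : ℤ) : ℝ) := by
    push_cast
    rw [← hb, ha, ← hr']
    ring
  have p : 0 < r.den * 2 * (L : ℝ) ^ 3 * (aperyA (N + 21) * Z - aperyB (N + 21)) := by positivity
  have q : r.den * 2 * (L : ℝ) ^ 3 * (aperyA (N + 21) * Z - aperyB (N + 21)) < 1 := by
    calc _ ≤ r.den * 2 * (L : ℝ) ^ 3 * (4 / 30 ^ N) := by gcongr
      _ = (r.den * 8 * 30 ^ 21) * (L ^ 3 / 30 ^ (N + 21)) := by rw [pow_add]; field_simp; norm_num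
      _ < (r.den * 8 * 30 ^ 21) * (1 / (r.den * 8 * 30 ^ 21)) := by gcongr
      _ = 1 := by field_simp
  rw [e] at p q
  have p' : 0 < 2 * (L : ℤ) ^ 3 * a * r.num - r.den * b := by exact_mod_cast p
  have q' : 2 * (L : ℤ) ^ 3 * a * r.num - r.den * b < 1 := by exact_mod_cast q
  lia

/-- The numbers `n/2, n/3, n/7, n/42` (rounded down). -/
def egyptianParts (n : ℕ) : Fin 4 → ℕ := ![n / 2, n / 3, n / 7, n / 42]

theorem prime_dvd_multinomial_egyptianParts {n p : ℕ} (hp : p.Prime) (h1 : n / 42 < p) (h2 : p ≤ n) :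
    p ∣ Nat.multinomial univ (egyptianParts n) * n.descFactorial (n - ∑ i, egyptianParts n i) := by
  set M := Nat.multinomial univ (egyptianParts n) * n.descFactorial (n - ∑ i, egyptianParts n i)
    with hM
  have hle : ∑ i, egyptianParts n i ≤ n := by
    simp [Fin.sum_univ_four, egyptianParts]; lia
  have hspec : (n / 2).factorial * (n / 3).factorial * (n / 7).factorial * (n / 42).factorial * M =
      n.factorial := by
    have e1 := Nat.multinomial_spec univ (egyptianParts n)
    have e2 := Nat.factorial_mul_descFactorial (Nat.sub_le n (∑ i, egyptianParts n i))
    rw [Nat.sub_sub_self hle, ← e1] at e2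
    rw [← e2, hM, Fin.prod_univ_four]
    simp [egyptianParts]
    ring
  have hM0 : M ≠ 0 := by
    intro h
    rw [h, mul_zero] at hspec
    exact n.factorial_ne_zero hspec.symm
  have hfac (m : ℕ) (hm : m ≤ n) : m.factorial.factorization p =
      ∑ i ∈ Ico 1 (Nat.log p n + 1), m / p ^ i :=
    Nat.factorization_factorial hp (Nat.lt_succ_of_le (Nat.log_mono_right hm))
  have hf := congrArg (fun x => x.factorization p) hspec
  have hne (m : ℕ) : m.factorial ≠ 0 := m.factorial_ne_zero
  simp only [Nat.factorization_mul, ne_eq, mul_eq_zero, hne, hM0, or_self, not_false_eq_true,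
    Finsupp.add_apply] at hf
  rw [hfac _ (Nat.div_le_self _ _), hfac _ (Nat.div_le_self _ _), hfac _ (Nat.div_le_self _ _),
    hfac _ (Nat.div_le_self _ _), hfac _ le_rfl, ← sum_add_distrib, ← sum_add_distrib,
    ← sum_add_distrib] at hf
  have hlt : ∑ i ∈ Ico 1 (Nat.log p n + 1),
      (n / 2 / p ^ i + n / 3 / p ^ i + n / 7 / p ^ i + n / 42 / p ^ i) <
      ∑ i ∈ Ico 1 (Nat.log p n + 1), n / p ^ i := by
    refine sum_lt_sum (fun i _ => ?_) ⟨1, ?_, ?_⟩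
    · simp only [Nat.div_div_eq_div_mul]
      simp only [mul_comm _ (p ^ i), ← Nat.div_div_eq_div_mul]
      lia
    · have := Nat.log_pos hp.one_lt h2
      exact mem_Ico.2 ⟨le_rfl, by lia⟩
    · have e1 : 0 < n / p := Nat.div_pos h2 hp.pos
      have e2 : n / p < 42 := by
        rw [Nat.div_lt_iff_lt_mul hp.pos]; lia
      simp only [Nat.div_div_eq_div_mul, pow_one]
      simp only [mul_comm _ p, ← Nat.div_div_eq_div_mul]
      lia
  refine Nat.dvd_of_factorization_pos (n := M) (by lia)

theorem primorial_le_mul (n : ℕ) : primorial n ≤ primorial (n / 42) *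
    (Nat.multinomial univ (egyptianParts n) * n.descFactorial (n - ∑ i, egyptianParts n i)) := by
  set M := Nat.multinomial univ (egyptianParts n) * n.descFactorial (n - ∑ i, egyptianParts n i)
  have hM : 0 < M := Nat.mul_pos (Nat.multinomial_pos _ _)
    (Nat.pos_of_ne_zero fun h => by have := Nat.descFactorial_eq_zero_iff_lt.1 h; lia)
  have hdvd : ∏ p ∈ Ioc (n / 42) n with p.Prime, p ∣ M := by
    refine prod_primes_dvd M (fun p hp => ?_) fun p hp => ?_
    · exact (mem_filter.1 hp).2.prime
    · simp only [mem_filter, mem_Ioc] at hp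
      exact prime_dvd_multinomial_egyptianParts hp.2 hp.1.1 hp.1.2
  have hsplit : primorial n = primorial (n / 42) * ∏ p ∈ Ioc (n / 42) n with p.Prime, p := by
    rw [primorial, primorial, ← prod_union]
    · congr 1
      ext p
      simp only [mem_filter, mem_union, mem_range, mem_Ioc]
      have := Nat.div_le_self n 42
      by_cases hp : p.Prime <;> simp [hp]
      lia
    · rw [disjoint_left]
      intro p hp hp'
      simp only [mem_filter, mem_range, mem_Ioc] at hp hp'
      lia
  rw [hsplit]
  exact Nat.mul_le_mul_left _ (Nat.le_of_dvd hM hdvd)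

theorem multinomial_mul_prod_pow_le {α : Type*} [DecidableEq α] (s : Finset α) (f k : α → ℕ) :
    Nat.multinomial s k * ∏ i ∈ s, f i ^ k i ≤ (∑ i ∈ s, f i) ^ ∑ i ∈ s, k i := by
  rw [sum_pow_eq_sum_piAntidiag]
  let k' : α → ℕ := fun i => if i ∈ s then k i else 0
  have e1 : Nat.multinomial s k = Nat.multinomial s k' :=
    Nat.multinomial_congr fun i hi => by simp [k', hi]
  have e2 : ∏ i ∈ s, f i ^ k i = ∏ i ∈ s, f i ^ k' i :=
    prod_congr rfl fun i hi => by simp [k', hi]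
  rw [e1, e2]
  refine single_le_sum (f := fun k => Nat.multinomial s k * ∏ i ∈ s, f i ^ k i)
    (fun _ _ => Nat.zero_le _) ?_
  simp only [mem_piAntidiag, k']
  refine ⟨sum_congr rfl fun i hi => by simp [hi], fun i hi => by by_contra h; simp [h] at hi⟩

theorem log_multinomial_egyptianParts_le (n : ℕ) :
    Real.log (Nat.multinomial univ (egyptianParts n)) ≤
      n / 42 * (21 * Real.log 2 + 14 * Real.log 3 + 6 * Real.log 7 + Real.log 42) := by
  have h := multinomial_mul_prod_pow_le univ ![21, 14, 6, 1] (egyptianParts n)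
  simp only [Fin.prod_univ_four, Fin.sum_univ_four, egyptianParts] at h
  simp at h
  set m := Nat.multinomial univ ![n / 2, n / 3, n / 7, n / 42] with hm
  have hm0 : 0 < m := Nat.multinomial_pos _ _
  have h' : (m : ℝ) * (21 ^ (n / 2) * 14 ^ (n / 3) * 6 ^ (n / 7)) ≤
      42 ^ (n / 2 + n / 3 + n / 7 + n / 42) := by exact_mod_cast h
  have hm0' : (0 : ℝ) < m := by exact_mod_cast hm0
  have hl := Real.log_le_log (by positivity) h'
  rw [Real.log_mul (by positivity) (by positivity), Real.log_mul (by positivity) (by positivity),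
    Real.log_mul (by positivity) (by positivity), Real.log_pow, Real.log_pow, Real.log_pow,
    Real.log_pow] at hl
  have a2 : Real.log 42 = Real.log 2 + Real.log 21 := by
    rw [← Real.log_mul (by norm_num) (by norm_num)]; norm_num
  have a3 : Real.log 42 = Real.log 3 + Real.log 14 := by
    rw [← Real.log_mul (by norm_num) (by norm_num)]; norm_num
  have a7 : Real.log 42 = Real.log 7 + Real.log 6 := by
    rw [← Real.log_mul (by norm_num) (by norm_num)]; norm_num
  have b2 : ((n / 2 : ℕ) : ℝ) * Real.log 2 ≤ n / 2 * Real.log 2 := by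
    gcongr; exact Nat.cast_div_le
  have b3 : ((n / 3 : ℕ) : ℝ) * Real.log 3 ≤ n / 3 * Real.log 3 := by
    gcongr; exact Nat.cast_div_le
  have b7 : ((n / 7 : ℕ) : ℝ) * Real.log 7 ≤ n / 7 * Real.log 7 := by
    gcongr; exact Nat.cast_div_le
  have b42 : ((n / 42 : ℕ) : ℝ) * Real.log 42 ≤ n / 42 * Real.log 42 := by
    gcongr; exact Nat.cast_div_le
  push_cast at hl
  have c2 : Real.log 21 = Real.log 42 - Real.log 2 := by linarith
  have c3 : Real.log 14 = Real.log 42 - Real.log 3 := by linarith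
  have c7 : Real.log 6 = Real.log 42 - Real.log 7 := by linarith
  rw [c2, c3, c7] at hl
  change Real.log m ≤ _
  linarith

theorem log_primorial_le {n : ℕ} (hn : 0 < n) :
    Real.log (primorial n) ≤ n * (Real.log 29 / 3) + 3 * Real.log n := by
  have h1 := primorial_le_mul n
  have h2 := log_multinomial_egyptianParts_le n
  have h3 : n.descFactorial (n - ∑ i, egyptianParts n i) ≤ n ^ 3 :=
    (Nat.descFactorial_le_pow _ _).trans (Nat.pow_le_pow_right hn (by
      simp [Fin.sum_univ_four, egyptianParts]; lia))
  have h4 := primorial_le_four_pow (n / 42)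
  set m := Nat.multinomial univ (egyptianParts n)
  have hm0 : (0 : ℝ) < m := by exact_mod_cast Nat.multinomial_pos _ _
  have hn' : (0 : ℝ) < n := by exact_mod_cast hn
  have h5 : (primorial n : ℝ) ≤ 4 ^ (n / 42) * (m * n ^ 3) := by
    have : primorial n ≤ 4 ^ (n / 42) * (m * n ^ 3) := h1.trans (by gcongr)
    exact_mod_cast this
  have hp : (0 : ℝ) < primorial n := by exact_mod_cast primorial_pos n
  have hl := Real.log_le_log hp h5
  rw [Real.log_mul (by positivity) (by positivity), Real.log_mul (by positivity) (by positivity),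
    Real.log_pow, Real.log_pow] at hl
  have b42 : ((n / 42 : ℕ) : ℝ) * Real.log 4 ≤ n / 42 * Real.log 4 := by
    gcongr; exact Nat.cast_div_le
  have key : 21 * Real.log 2 + 14 * Real.log 3 + 6 * Real.log 7 + Real.log 42 + Real.log 4 ≤
      14 * Real.log 29 := by
    have := Real.log_le_log (x := 2 ^ 21 * 3 ^ 14 * 7 ^ 6 * 42 * 4) (y := 29 ^ 14) (by norm_num)
      (by norm_num)
    rw [Real.log_mul (by norm_num) (by norm_num), Real.log_mul (by norm_num) (by norm_num),
      Real.log_mul (by norm_num) (by norm_num), Real.log_mul (by norm_num) (by norm_num),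
      Real.log_pow, Real.log_pow, Real.log_pow, Real.log_pow] at this
    exact_mod_cast this
  have key' := mul_le_mul_of_nonneg_left key (show (0 : ℝ) ≤ n / 42 by positivity)
  push_cast at hl
  linarith

theorem log_lcmUpto_le {n : ℕ} (hn : 0 < n) :
    Real.log n.lcmUpto ≤ n * (Real.log 29 / 3) + 3 * Real.log n + 2 * √n * Real.log n := by
  have h1 := Chebyshev.psi_sub_theta_le (x := n) (by exact_mod_cast hn)
  have h2 := log_primorial_le hn
  rw [Chebyshev.psi_eq_log_lcmUpto, Chebyshev.theta_eq_log_primorial, Nat.floor_natCast] at h1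
  linarith

theorem tendsto_lcmUpto_cube_div :
    Tendsto (fun n : ℕ => (n.lcmUpto : ℝ) ^ 3 / 30 ^ n) atTop (𝓝 0) := by
  have hlog : Real.log 29 < Real.log 30 := Real.log_lt_log (by norm_num) (by norm_num)
  set δ := Real.log 30 - Real.log 29 with hδ
  have hδ0 : 0 < δ := by linarith
  have hev : ∀ᶠ n : ℕ in atTop, 9 * Real.log n + 6 * √n * Real.log n ≤ δ / 2 * n := by
    have h1 : (fun x : ℝ => 9 * Real.log x + 6 * √x * Real.log x) =o[atTop] fun x : ℝ => x := by
      have e1 : Real.log =o[atTop] fun x : ℝ => x := Real.isLittleO_log_id_atTop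
      have e2 : (fun x : ℝ => √x * Real.log x) =o[atTop] fun x : ℝ => √x * x ^ (1 / 2 : ℝ) :=
        (Asymptotics.isBigO_refl _ _).mul_isLittleO
          (isLittleO_log_rpow_atTop (by norm_num : (0 : ℝ) < 1 / 2))
      have e3 : (fun x : ℝ => √x * Real.log x) =o[atTop] fun x : ℝ => x := by
        refine e2.congr' EventuallyEq.rfl ?_
        filter_upwards [eventually_ge_atTop 0] with x hx
        rw [← Real.sqrt_eq_rpow, Real.mul_self_sqrt hx]
      have := (e1.const_mul_left 9).add (e3.const_mul_left 6)
      simpa [mul_assoc] using this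
    have h2 := (h1.comp_tendsto tendsto_natCast_atTop_atTop).def (half_pos hδ0)
    filter_upwards [h2] with n hn
    simp only [Function.comp_apply, Real.norm_eq_abs, Nat.abs_cast] at hn
    exact (le_abs_self _).trans hn
  have hexp : Tendsto (fun n : ℕ => Real.exp (-(δ / 2)) ^ n) atTop (𝓝 0) :=
    tendsto_pow_atTop_nhds_zero_of_lt_one (Real.exp_pos _).le
      (Real.exp_lt_one_iff.2 (by linarith))
  refine squeeze_zero' (Eventually.of_forall fun n => by positivity) ?_ hexp
  filter_upwards [hev, eventually_gt_atTop 0] with n hn hn0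
  have hL : (0 : ℝ) < n.lcmUpto := by exact_mod_cast Nat.lcmUpto_pos n
  rw [← Real.exp_nat_mul, ← Real.log_le_iff_le_exp (by positivity),
    Real.log_div (by positivity) (by positivity), Real.log_pow, Real.log_pow]
  have := log_lcmUpto_le hn0
  push_cast
  have e : Real.log 30 = δ + Real.log 29 := by rw [hδ]; ring
  rw [e]
  linarith

open Polynomial in
theorem isIntegral_pow_mul_aeval {a : ℤ} {x : ℂ} (hx : IsIntegral ℤ (a * x)) {g : ℤ[X]} {N : ℕ}
    (hg : g.natDegree ≤ N) : IsIntegral ℤ ((a : ℂ) ^ N * aeval x g) := by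
  rw [aeval_eq_sum_range, mul_sum]
  refine IsIntegral.sum _ fun j hj => ?_
  have hjN : j ≤ N := by have := mem_range.1 hj; lia
  have e : (a : ℂ) ^ N * g.coeff j • x ^ j =
      ((a ^ (N - j) * g.coeff j : ℤ) : ℂ) * ((a : ℂ) * x) ^ j := by
    conv_lhs => rw [← Nat.sub_add_cancel hjN, pow_add]
    rw [zsmul_eq_mul]
    push_cast
    ring
  rw [e]
  exact (isIntegral_algebraMap (x := a ^ (N - j) * g.coeff j)).mul (hx.pow j)

open Polynomial in
theorem exists_int_polynomial_of_isAlgebraic {ι : Type*} (I : Finset ι) (s : ι → ℂ)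
    (hs0 : ∀ i ∈ I, s i ≠ 0) (halg : ∀ i ∈ I, IsAlgebraic ℤ (s i)) :
    ∃ f : ℤ[X], f.coeff 0 ≠ 0 ∧ ∀ i ∈ I, aeval (s i) f = 0 := by
  classical
  have H (i : ι) : ∃ f : ℤ[X], f.coeff 0 ≠ 0 ∧ (i ∈ I → aeval (s i) f = 0) := by
    by_cases hi : i ∈ I
    · obtain ⟨q, hq, hq'⟩ := (halg i hi).exists_nonzero_coeff_and_aeval_eq_zero
        (mem_nonZeroDivisors_of_ne_zero (hs0 i hi))
      exact ⟨q, hq, fun _ => hq'⟩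
    · exact ⟨1, by simp, fun h => absurd h hi⟩
  choose F hF hF' using H
  refine ⟨∏ i ∈ I, F i, ?_, fun i hi => ?_⟩
  · rw [coeff_zero_eq_eval_zero, eval_prod, prod_ne_zero_iff]
    intro i _
    rw [← coeff_zero_eq_eval_zero]
    exact hF i
  · rw [map_prod]
    exact prod_eq_zero hi (hF' i hi)

open Polynomial in
theorem natCast_add_sum_exp_ne_zero {ι : Type*} (I : Finset ι) (s : ι → ℂ)
    (hs0 : ∀ i ∈ I, s i ≠ 0) (halg : ∀ i ∈ I, IsAlgebraic ℤ (s i))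
    (hinv : ∀ g : ℤ[X], ∃ q : ℚ, ∑ i ∈ I, aeval (s i) g = q) {k : ℕ} (hk : 0 < k) :
    (k : ℂ) + ∑ i ∈ I, Complex.exp (s i) ≠ 0 := by
  intro h0
  obtain ⟨f, hf0, hf⟩ := exists_int_polynomial_of_isAlgebraic I s hs0 halg
  rw [coeff_zero_eq_eval_zero] at hf0
  have hfne : f ≠ 0 := by rintro rfl; simp at hf0
  set a : ℤ := f.leadingCoeff
  have ha : a ≠ 0 := leadingCoeff_ne_zero.2 hfne
  set D := f.natDegree
  have hmul_int : ∀ i ∈ I, IsIntegral ℤ ((a : ℂ) * s i) := fun i hi => by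
    simpa [zsmul_eq_mul] using isIntegral_leadingCoeff_smul f (s i) (hf i hi)
  obtain ⟨c, hc⟩ := LindemannWeierstrass.exp_polynomial_approx f hf0
  have hlim : Tendsto (fun p : ℕ => (#I : ℝ) * |(a : ℝ)| ^ D * |c| *
      ((|(a : ℝ)| ^ D * |c|) ^ (p - 1) / (p - 1).factorial)) atTop (𝓝 0) := by
    have := ((FloorSemiring.tendsto_pow_div_factorial_atTop (|(a : ℝ)| ^ D * |c|)).comp
      (tendsto_sub_atTop_nat 1)).const_mul ((#I : ℝ) * |(a : ℝ)| ^ D * |c|)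
    simpa using this
  obtain ⟨p₀, hp₀⟩ := eventually_atTop.1 (hlim.eventually_lt_const one_pos)
  obtain ⟨p, hpge, hp⟩ := Nat.exists_infinite_primes
    (p₀ + (eval 0 f).natAbs + k + a.natAbs + 1)
  obtain ⟨n, hn, g, hg, happ⟩ := hc p (by lia) hp
  obtain ⟨q, hq⟩ := hinv g
  -- the integer obtained from the power sums
  have hz : ∃ z : ℤ, (a : ℂ) ^ (p * D) * ∑ i ∈ I, aeval (s i) g = z := by
    have h1 : IsIntegral ℤ ((a : ℂ) ^ (p * D) * ∑ i ∈ I, aeval (s i) g) := by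
      rw [mul_sum]
      exact IsIntegral.sum _ fun i hi => isIntegral_pow_mul_aeval (hmul_int i hi) (by lia)
    have h2 : (a : ℂ) ^ (p * D) * ∑ i ∈ I, aeval (s i) g = algebraMap ℚ ℂ (a ^ (p * D) * q) := by
      rw [hq]; simp
    rw [h2] at h1
    have h3 : IsIntegral ℤ ((a : ℚ) ^ (p * D) * q) :=
      (isIntegral_algHom_iff ((Algebra.ofId ℚ ℂ).restrictScalars ℤ)
        (algebraMap ℚ ℂ).injective).1 h1
    obtain ⟨z, hz⟩ := IsIntegrallyClosed.isIntegral_iff.1 h3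
    exact ⟨z, by rw [h2, ← hz]; simp⟩
  obtain ⟨z, hz⟩ := hz
  have hne : a ^ (p * D) * n * k + p * z ≠ 0 := by
    intro h
    have hd : (p : ℤ) ∣ a ^ (p * D) * n * k :=
      ⟨-z, by linarith⟩
    have hp' := Nat.prime_iff_prime_int.1 hp
    rcases hp'.dvd_or_dvd hd with hd | hd
    · rcases hp'.dvd_or_dvd hd with hd | hd
      · have := Int.natAbs_dvd_natAbs.2 (hp'.dvd_of_dvd_pow hd)
        rw [Int.natAbs_natCast] at this
        have := Nat.le_of_dvd (Int.natAbs_pos.2 ha) this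
        lia
      · exact hn hd
    · have := Nat.le_of_dvd hk (Int.natCast_dvd_natCast.1 hd)
      lia
  have hone : (1 : ℝ) ≤ ‖((a ^ (p * D) * n * k + p * z : ℤ) : ℂ)‖ := by
    rw [Complex.norm_intCast]
    exact_mod_cast Int.one_le_abs hne
  have heq : ((a ^ (p * D) * n * k + p * z : ℤ) : ℂ) =
      -((a : ℂ) ^ (p * D) * ∑ i ∈ I, (n • Complex.exp (s i) - p • aeval (s i) g)) := by
    push_cast
    rw [← hz, sum_sub_distrib, ← smul_sum, ← smul_sum, eq_neg_of_add_eq_zero_right h0,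
      zsmul_eq_mul, nsmul_eq_mul]
    ring
  have hle : ‖((a ^ (p * D) * n * k + p * z : ℤ) : ℂ)‖ ≤
      |(a : ℝ)| ^ (p * D) * (#I * (|c| ^ p / (p - 1).factorial)) := by
    rw [heq, norm_neg, norm_mul, norm_pow, Complex.norm_intCast]
    refine mul_le_mul_of_nonneg_left ?_ (by positivity)
    refine (norm_sum_le_of_le _ fun i hi => ?_).trans (by rw [sum_const, nsmul_eq_mul])
    refine (happ (mem_aroots.2 ⟨hfne, hf i hi⟩)).trans ?_
    refine div_le_div_of_nonneg_right ?_ (by positivity)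
    rw [← abs_pow]
    exact le_abs_self _
  have hlt := hp₀ p (by lia)
  obtain ⟨r, rfl⟩ : ∃ r, p = r + 1 := ⟨p - 1, by have := hp.pos; lia⟩
  refine absurd (hone.trans hle) (not_le.2 (lt_of_eq_of_lt ?_ hlt))
  simp only [Nat.add_sub_cancel]
  rw [mul_pow, ← pow_mul]
  ring

open Polynomial in
theorem exists_isGalois_splits {F : Type} (K : Type*) [Field F] [Field K] [IsAlgClosed K]
    [Algebra F K] {m : F[X]} (hm : m.Separable) :
    ∃ (L : Type) (_ : Field L) (_ : Algebra F L) (_ : IsGalois F L)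
      (_ : FiniteDimensional F L), Nonempty (L →ₐ[F] K) ∧ (m.map (algebraMap F L)).Splits :=
  ⟨m.SplittingField, inferInstance, inferInstance, IsGalois.of_separable_splitting_field hm,
    inferInstance, ⟨SplittingField.lift m (IsAlgClosed.splits _)⟩, SplittingField.splits m⟩

open Polynomial in
theorem not_isAlgebraic_pi_mul_I : ¬ IsAlgebraic ℚ (Real.pi * Complex.I) := by
  intro halg
  classical
  set w : ℂ := Real.pi * Complex.I
  set m := minpoly ℚ w
  have hm : m ≠ 0 := minpoly.ne_zero halg.isIntegral
  obtain ⟨L, _, _, _, _, ⟨φ⟩, hLs⟩ := exists_isGalois_splits ℂ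
    (minpoly.irreducible halg.isIntegral).separable
  set R : Finset L := (m.aroots L).toFinset
  have hR (x : L) : x ∈ R ↔ aeval x m = 0 := by simp [R, hm]
  have hw : ∃ x ∈ R, φ x = w := by
    have h := hLs.image_rootSet φ
    have hwm : w ∈ m.rootSet ℂ := (mem_rootSet_of_ne hm).2 (minpoly.aeval ℚ w)
    rw [← h] at hwm
    obtain ⟨x, hx, hxw⟩ := hwm
    exact ⟨x, (hR x).2 ((mem_rootSet_of_ne hm).1 hx), hxw⟩
  have hσ (σ : L ≃ₐ[ℚ] L) (x : L) : σ x ∈ R ↔ x ∈ R := by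
    rw [hR, hR, aeval_algHom_apply, EmbeddingLike.map_eq_zero_iff]
  set s : Finset L → ℂ := fun T => φ (∑ x ∈ T, x)
  have hprod : ∑ T ∈ R.powerset, Complex.exp (s T) = 0 := by
    simp only [s, map_sum, Complex.exp_sum]
    rw [← prod_one_add]
    obtain ⟨x, hx, hxw⟩ := hw
    exact prod_eq_zero hx (by rw [hxw, Complex.exp_pi_mul_I]; ring)
  set I := R.powerset.filter fun T => ∑ x ∈ T, x ≠ 0
  set J := R.powerset.filter fun T => ¬ ∑ x ∈ T, x ≠ 0
  have hsplit : (#J : ℂ) + ∑ T ∈ I, Complex.exp (s T) = 0 := by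
    rw [← hprod, ← sum_filter_add_sum_filter_not R.powerset (fun T => ∑ x ∈ T, x ≠ 0), add_comm]
    congr 1
    rw [card_eq_sum_ones, Nat.cast_sum]
    refine sum_congr rfl fun T hT => ?_
    have := not_not.1 (mem_filter.1 hT).2
    simp only [s, this, map_zero, Complex.exp_zero, Nat.cast_one]
  refine natCast_add_sum_exp_ne_zero I s (fun T hT => ?_) (fun T hT => ?_) (fun g => ?_)
    (card_pos.2 ⟨∅, by simp [J]⟩) hsplit
  · exact (map_ne_zero_iff φ φ.injective).2 (mem_filter.1 hT).2
  · have : IsAlgebraic ℚ (s T) := 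
      (Algebra.IsAlgebraic.isAlgebraic (R := ℚ) (∑ x ∈ T, x)).algHom φ
    exact (IsFractionRing.isAlgebraic_iff ℤ ℚ ℂ).2 this
  · have hfix : ∑ T ∈ I, aeval (∑ x ∈ T, x) g ∈ (⊥ : IntermediateField ℚ L) := by
      rw [IsGalois.mem_bot_iff_fixed]
      intro σ
      rw [map_sum]
      have hmem (τ : L ≃ₐ[ℚ] L) : ∀ T ∈ I, T.image τ ∈ I := by
        intro T hT
        simp only [I, mem_filter, mem_powerset] at hT ⊢
        refine ⟨image_subset_iff.2 fun x hx => (hσ τ x).2 (hT.1 hx), ?_⟩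
        rw [sum_image τ.injective.injOn, ← map_sum]
        exact (map_ne_zero_iff τ τ.injective).2 hT.2
      refine sum_bij' (fun T _ => T.image σ) (fun T _ => T.image σ.symm)
        (hmem σ) (hmem σ.symm) (fun T _ => ?_) (fun T _ => ?_) fun T _ => ?_
      · simp [image_image, Function.comp_def]
      · simp [image_image, Function.comp_def]
      · rw [sum_image σ.injective.injOn, ← map_sum]
        exact (aeval_algHom_apply ((σ : L →ₐ[ℚ] L).restrictScalars ℤ) _ g).symm
    obtain ⟨q, hq⟩ := IntermediateField.mem_bot.1 hfix
    refine ⟨q, ?_⟩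
    have := congrArg φ hq
    rw [map_sum, φ.commutes, eq_ratCast] at this
    rw [this]
    exact sum_congr rfl fun T _ => aeval_algHom_apply (φ.restrictScalars ℤ) _ g

theorem transcendental_pi : Transcendental ℚ Real.pi := by
  intro h
  refine not_isAlgebraic_pi_mul_I ?_
  have h1 : IsAlgebraic ℚ (Real.pi : ℂ) := h.algebraMap (A := ℂ)
  have h2 : IsAlgebraic ℚ Complex.I := Complex.isIntegral_rat_I.isAlgebraic
  exact h1.mul h2

def posTupleEquiv (s : ℕ) :
    ℕ ≃ {n : Fin [s].length → ℕ // StrictAnti n ∧ ∀ i, 0 < n i} where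
  toFun m := ⟨fun _ => m + 1, Subsingleton.strictAnti (α := Fin 1) _, fun _ => m.succ_pos⟩
  invFun n := n.1 (0 : Fin 1) - 1
  left_inv m := rfl
  right_inv n := by
    ext i
    obtain rfl : i = (0 : Fin 1) := Subsingleton.elim (α := Fin 1) _ _
    exact Nat.sub_add_cancel (n.2.2 _)

theorem mzv_singleton (s : ℕ) : mzv [s] = ∑' m : ℕ, 1 / ((m : ℝ) + 1) ^ s := by
  rw [mzv, ← (posTupleEquiv s).tsum_eq]
  refine tsum_congr fun m => ?_
  simp [posTupleEquiv]

theorem irrational_mzv_three : Irrational (mzv [3]) := by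
  rw [mzv_singleton]
  exact irrational_tsum_inv_cube tendsto_lcmUpto_cube_div

theorem Transcendental.linearIndependent_pow {R A : Type*} [CommRing R] [CommRing A] [Algebra R A]
    {x : A} (hx : Transcendental R x) : LinearIndependent R fun n : ℕ => x ^ n := by
  have h := (Polynomial.basisMonomials R).linearIndependent.map'
    (Polynomial.aeval x).toLinearMap
    (LinearMap.ker_eq_bot.2 (transcendental_iff_injective.1 hx))
  have e : (fun n : ℕ => x ^ n) =
      (Polynomial.aeval x).toLinearMap ∘ Polynomial.basisMonomials R := by
    funext n
    simp
  rw [e]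
  exact h

theorem exists_mzv_two_mul_eq {k : ℕ} (hk : k ≠ 0) :
    ∃ q : ℚ, q ≠ 0 ∧ mzv [2 * k] = q * Real.pi ^ (2 * k) := by
  have h := hasSum_zeta_nat hk
  have h1 : mzv [2 * k] = ∑' n : ℕ, 1 / (n : ℝ) ^ (2 * k) := by
    rw [h.summable.tsum_eq_zero_add, mzv_singleton]
    simp [hk]
  have hpos : 0 < mzv [2 * k] := by
    rw [h1]
    exact h.summable.tsum_pos (fun n => by positivity) 1 (by simp)
  have heq : mzv [2 * k] = ((-1 : ℚ) ^ (k + 1) * 2 ^ (2 * k - 1) * bernoulli (2 * k) /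
      (2 * k).factorial : ℚ) * Real.pi ^ (2 * k) := by
    rw [h1, h.tsum_eq]
    push_cast
    ring
  refine ⟨_, fun h0 => ?_, heq⟩
  rw [heq, h0] at hpos
  simp at hpos

/-- The numbers `ζ(3) ζ(2k)`, where the entry at `k = 0` is `ζ(3)` itself, are linearly
independent over `ℚ`. -/
theorem linearIndependent_mzv_three_mul : LinearIndependent ℚ
    (fun k : ℕ => mzv [3] * if k = 0 then 1 else mzv [2 * k]) := by
  have hq (k : ℕ) : ∃ q : ℚˣ, (if k = 0 then 1 else mzv [2 * k]) = q • Real.pi ^ (2 * k) := by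
    by_cases hk : k = 0
    · exact ⟨1, by simp [hk]⟩
    · obtain ⟨q, hq, h⟩ := exists_mzv_two_mul_eq hk
      exact ⟨Units.mk0 q hq, by rw [if_neg hk, h, Units.smul_mk0, Rat.smul_def]⟩
  choose q hq using hq
  have h1 : LinearIndependent ℚ fun k : ℕ => Real.pi ^ (2 * k) :=
    transcendental_pi.linearIndependent_pow.comp (fun k => 2 * k)
      (mul_right_injective₀ two_ne_zero)
  have h2 := (h1.units_smul q).map' (LinearMap.mulLeft ℚ (mzv [3]))
    (LinearMap.ker_eq_bot.2 (mul_right_injective₀ irrational_mzv_three.ne_zero))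
  have e : (fun k : ℕ => mzv [3] * if k = 0 then 1 else mzv [2 * k]) =
      LinearMap.mulLeft ℚ (mzv [3]) ∘ (q • fun k : ℕ => Real.pi ^ (2 * k)) := by
    funext k
    simp only [hq, Function.comp_apply, LinearMap.mulLeft_apply, Pi.smul_apply']
  rw [e]
  exact h2

theorem LinearIndependent.exists_mem_notMem_span_image_diff {ι K V : Type*} [DivisionRing K]
    [AddCommGroup V] [Module K V] {v : ι → V} (hv : LinearIndependent K v) {e : V} {A B : Set ι}
    (hB : B.Nonempty) (he : e ∉ Submodule.span K (v '' (A \ B))) :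
    ∃ k ∈ B, e ∉ Submodule.span K (v '' (A \ {k})) := by
  by_contra! h
  simp only [Finsupp.span_image_eq_map_linearCombination, Submodule.mem_map] at h he
  obtain ⟨k₀, hk₀⟩ := hB
  obtain ⟨c, hc, rfl⟩ := h k₀ hk₀
  refine he ⟨c, ?_, rfl⟩
  have hsub (k : ι) (hk : k ∈ B) : (c.support : Set ι) ⊆ A \ {k} := by
    obtain ⟨d, hd, hdc⟩ := h k hk
    rw [← hv hdc]
    exact hd
  exact fun i hi => ⟨(hsub k₀ hk₀ hi).1, fun hiB => (hsub i hiB hi).2 rfl⟩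

end

/-- For any positive integer `l`, there is an `l`-element subset `S ⊆ {1, …, l+1}` such that
`1`, `ζ(3)` and the numbers `ζ(3)·ζ(2k)`, `k ∈ S`, are linearly independent over `ℚ`. -/
theorem stmt_1 (l : ℕ) (hl : 0 < l) :
    ∃ S : Finset ℕ, S ⊆ Finset.Icc 1 (l + 1) ∧ S.card = l ∧
      LinearIndependent ℚ
        (Sum.elim ![(1 : ℝ), mzv [3]] (fun k : {x // x ∈ S} => mzv [3] * mzv [2 * k.1])) := by
  set v : ℕ → ℝ := fun k => mzv [3] * if k = 0 then 1 else mzv [2 * k]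
  have hv : LinearIndependent ℚ v := linearIndependent_mzv_three_mul
  have he : (1 : ℝ) ∉ Submodule.span ℚ (v '' (Set.Iic (l + 1) \ Set.Icc 1 (l + 1))) := by
    have h0 : Set.Iic (l + 1) \ Set.Icc 1 (l + 1) = {0} := by
      ext i
      simp only [Set.mem_sdiff, Set.mem_Iic, Set.mem_Icc, Set.mem_singleton_iff]
      lia
    rw [h0, Set.image_singleton, Submodule.mem_span_singleton]
    rintro ⟨q, hq⟩
    simp only [v, if_pos, mul_one, Rat.smul_def] at hq
    refine irrational_mzv_three ⟨q⁻¹, ?_⟩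
    rw [Rat.cast_inv]
    exact (eq_inv_of_mul_eq_one_right hq).symm
  obtain ⟨k, hk, hek⟩ := hv.exists_mem_notMem_span_image_diff ⟨1, by simp⟩ he
  have hk' : k ∈ Finset.Icc 1 (l + 1) := Finset.mem_Icc.2 hk
  refine ⟨(Finset.Icc 1 (l + 1)).erase k, Finset.erase_subset _ _, ?_, ?_⟩
  · rw [Finset.card_erase_of_mem hk', Nat.card_Icc]
    lia
  set A : Set ℕ := Set.Iic (l + 1) \ {k}
  have hopt := linearIndependent_option'.2
    ⟨hv.comp ((↑) : A → ℕ) Subtype.val_injective, by rwa [Set.range_comp, Subtype.range_coe]⟩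
  have h0A : 0 ∈ A := ⟨by simp, by have := hk.1; simp; lia⟩
  have hSA (i : {x // x ∈ (Finset.Icc 1 (l + 1)).erase k}) : i.1 ∈ A := by
    have := i.2
    simp only [Finset.mem_erase, Finset.mem_Icc] at this
    exact ⟨this.2.2, this.1⟩
  have hS0 (i : {x // x ∈ (Finset.Icc 1 (l + 1)).erase k}) : i.1 ≠ 0 := by
    have := i.2
    simp only [Finset.mem_erase, Finset.mem_Icc] at this
    lia
  set u : Fin 2 ⊕ {x // x ∈ (Finset.Icc 1 (l + 1)).erase k} → Option A :=
    Sum.elim ![none, some ⟨0, h0A⟩] fun i => some ⟨i.1, hSA i⟩ with hu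
  have hinj : Function.Injective u := by
    rintro (i | i) (j | j) h
    · fin_cases i <;> fin_cases j <;> simp_all
    · fin_cases i
      · simp [hu] at h
      · simp [hu, (hS0 j).symm] at h
    · fin_cases j
      · simp [hu] at h
      · simp [hu, hS0 i] at h
    · have h' : some (⟨i.1, hSA i⟩ : A) = some ⟨j.1, hSA j⟩ := h
      have h'' : i.1 = j.1 := Subtype.mk.inj (Option.some.inj h')
      exact congrArg Sum.inr (Subtype.ext h'')
  have e : (Sum.elim ![(1 : ℝ), mzv [3]] fun i : {x // x ∈ (Finset.Icc 1 (l + 1)).erase k} =>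
      mzv [3] * mzv [2 * i.1]) =
      (fun o : Option A => o.casesOn' 1 (v ∘ ((↑) : A → ℕ))) ∘ u := by
    funext i
    rcases i with i | i
    · fin_cases i <;> simp [v, hu]
    · simp [v, hu, hS0 i]
  rw [e]
  exact hopt.comp u hinj
end

section
/- For each integer w ≥ 2, let M_w be a set of compositions (finite tuples of positive integers with first entry ≥ 2) of weight w such that every multiple zeta value of weight w is a linear combination with rational coefficients of the values ζ(s⃗) with s⃗ ∈ M_w. Then for any positive integer l there exist a subset I ⊆ {5, 7, …, 2l+5} of odd numbers with #I = l, and for each i ∈ I a vector t⃗_i ∈ M_i, such that the l+2 numbers 1, ζ(3), and ζ(t⃗_i) for i ∈ I are linearly independent over ℚ. -/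
open scoped BigOperators

namespace Apery

/-- The product `C(n, k) C(n + k, k)` of binomial coefficients. -/
def lam (n k : ℕ) : ℚ := n.choose k * (n + k).choose k

lemma lam_zero_right (n : ℕ) : lam n 0 = 1 := by simp [lam]

lemma lam_eq_zero {n k : ℕ} (h : n < k) : lam n k = 0 := by
  simp [lam, Nat.choose_eq_zero_of_lt h]

lemma lam_pos {n k : ℕ} (h : k ≤ n) : 0 < lam n k := by
  have h1 := Nat.choose_pos h
  have h2 := Nat.choose_pos (Nat.le_add_left k n)
  unfold lam
  positivity

lemma lam_nonneg (n k : ℕ) : 0 ≤ lam n k := by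
  unfold lam
  positivity

lemma lam_succ_right (n k : ℕ) :
    lam n (k + 1) * ((k : ℚ) + 1) ^ 2 = lam n k * (n + k + 1) * (n - k) := by
  rcases lt_or_ge n k with h | h
  · rw [lam_eq_zero h, lam_eq_zero (by omega)]
    ring
  have h1 : (n.choose (k + 1) : ℚ) * (k + 1) = n.choose k * (n - k) := by
    have := Nat.choose_succ_right_eq n k
    rw [← Nat.cast_sub h]
    exact_mod_cast this
  have h2 : ((n + (k + 1)).choose (k + 1) : ℚ) * (k + 1) = (n + k + 1) * (n + k).choose k := by
    have := Nat.add_one_mul_choose_eq (n + k) k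
    rw [← add_assoc]
    exact_mod_cast this.symm
  unfold lam
  linear_combination ((n + (k + 1)).choose (k + 1) : ℚ) * (k + 1) * h1
    + (n.choose k * (n - k) : ℚ) * h2

lemma lam_succ_left (n k : ℕ) :
    lam (n + 1) k * ((n : ℚ) + 1 - k) = lam n k * (n + 1 + k) := by
  induction k with
  | zero => simp [lam_zero_right]
  | succ k ih =>
    have h1 := lam_succ_right n k
    have h2 := lam_succ_right (n + 1) k
    have h3 : ((k : ℚ) + 1) ^ 2 ≠ 0 := by positivity
    apply mul_right_cancel₀ h3
    push_cast at *
    linear_combination ((n : ℚ) - k) * h2 + (n - k) * (n + 1 + k + 1) * ih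
      - (n + k + 2) * h1

/-- The inner rational approximations to `ζ(3)`. -/
def approx (n k : ℕ) : ℚ :=
  ∑ m ∈ Finset.range n, 1 / ((m : ℚ) + 1) ^ 3 +
    ∑ m ∈ Finset.range k, (-1) ^ m / (2 * ((m : ℚ) + 1) ^ 3 * lam n (m + 1))

lemma approx_succ_right (n k : ℕ) :
    approx n (k + 1) = approx n k + (-1) ^ k / (2 * ((k : ℚ) + 1) ^ 3 * lam n (k + 1)) := by
  simp [approx, Finset.sum_range_succ, add_assoc]

lemma approx_succ_left {n k : ℕ} (h : k ≤ n) :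
    approx (n + 1) k - approx n k
      = (-1) ^ k / (((n : ℚ) + 1) ^ 2 * (n + 1 + k) * lam n k) := by
  induction k with
  | zero =>
    have : (n : ℚ) + 1 ≠ 0 := by positivity
    simp [approx, Finset.sum_range_succ, lam_zero_right]
    field_simp
  | succ k ih =>
    have ih := ih (by omega)
    rw [approx_succ_right, approx_succ_right]
    have h1 := lam_succ_right n k
    have h2 := lam_succ_left n (k + 1)
    have hk : (n : ℚ) - k ≠ 0 := by
      have : (k : ℚ) + 1 ≤ n := by exact_mod_cast h
      linarith
    have p0 : lam n k ≠ 0 := (lam_pos (by omega)).ne'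
    have hk1 : (k : ℚ) + 1 ≠ 0 := by positivity
    have hnk : (n : ℚ) + k + 1 ≠ 0 := by positivity
    have hnk' : (n : ℚ) + 1 + k ≠ 0 := by positivity
    have hnk2 : (n : ℚ) + k + 2 ≠ 0 := by positivity
    have hn1 : (n : ℚ) + 1 ≠ 0 := by positivity
    have e1 : lam n (k + 1) = lam n k * (n + k + 1) * (n - k) / ((k : ℚ) + 1) ^ 2 := by
      rw [eq_div_iff (by positivity), h1]
    have e2 : lam (n + 1) (k + 1) = lam n k * (n + k + 1) * (n + k + 2) / ((k : ℚ) + 1) ^ 2 := by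
      apply mul_right_cancel₀ hk
      push_cast at h2
      rw [e1] at h2
      linear_combination h2
    have e3 : approx (n + 1) k
        = approx n k + (-1) ^ k / (((n : ℚ) + 1) ^ 2 * (n + 1 + k) * lam n k) := by
      linear_combination ih
    rw [e3, e2, e1]
    have hnk3 : (n : ℚ) + 1 + (k + 1) ≠ 0 := by positivity
    push_cast
    field_simp
    ring

/-- Apéry's denominators. -/
def den (n : ℕ) : ℚ := ∑ k ∈ Finset.range (n + 1), lam n k ^ 2

/-- Apéry's numerators. -/
def num (n : ℕ) : ℚ := ∑ k ∈ Finset.range (n + 1), lam n k ^ 2 * approx n k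

/-- The middle coefficient of Apéry's recurrence. -/
def coeff (n : ℕ) : ℚ := 34 * ((n : ℚ) + 1) ^ 3 + 51 * ((n : ℚ) + 1) ^ 2 + 27 * ((n : ℚ) + 1) + 5

/-- The Zeilberger certificate for the denominators. -/
def cert (n k : ℕ) : ℚ :=
  4 * (2 * (n : ℚ) + 1) * (k * (2 * k + 1) - (2 * n + 1) ^ 2) * lam n k ^ 2

lemma lam_eqs (n k : ℕ) : ∃ μ : ℚ, lam (n + 1) k = μ * (k + 1) ^ 2 ∧
    lam (n + 1) (k + 1) = μ * (n + k + 2) * (n + 1 - k) ∧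
    lam (n + 2) (k + 1) = μ * (n + k + 2) * (n + k + 3) ∧
    lam n (k + 1) = μ * (n + 1 - k) * (n - k) := by
  have hk : ((k : ℚ) + 1) ^ 2 ≠ 0 := by positivity
  have h1 := lam_succ_right n k
  have h2 := lam_succ_right (n + 1) k
  have h3 := lam_succ_right (n + 2) k
  have h4 := lam_succ_left n k
  have h5 := lam_succ_left (n + 1) k
  push_cast at *
  refine ⟨lam (n + 1) k / (k + 1) ^ 2, ?_, ?_, ?_, ?_⟩ <;> field_simp
  · linear_combination h2
  · linear_combination h3 + ((n : ℚ) + k + 3) * h5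
  · linear_combination h1 - ((n : ℚ) - k) * h4

lemma sum_cert (n K : ℕ) :
    ∑ k ∈ Finset.range (K + 1), (((n : ℚ) + 2) ^ 3 * lam (n + 2) k ^ 2
      - coeff n * lam (n + 1) k ^ 2 + ((n : ℚ) + 1) ^ 3 * lam n k ^ 2) = cert (n + 1) K := by
  induction K with
  | zero =>
    simp [lam_zero_right, coeff, cert]
    ring
  | succ k ih =>
    rw [Finset.sum_range_succ, ih]
    obtain ⟨μ, h1, h2, h3, h4⟩ := lam_eqs n k
    simp only [cert, coeff, h1, h2, h3, h4]
    push_cast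
    ring

lemma sum_lam_mul (f : ℕ → ℚ) (n j : ℕ) :
    ∑ k ∈ Finset.range (n + 1 + j), lam n k ^ 2 * f k
      = ∑ k ∈ Finset.range (n + 1), lam n k ^ 2 * f k := by
  induction j with
  | zero => rfl
  | succ j ih =>
    rw [← add_assoc, Finset.sum_range_succ, ih, lam_eq_zero (by omega)]
    simp

lemma den_recurrence (n : ℕ) :
    ((n : ℚ) + 2) ^ 3 * den (n + 2) - coeff n * den (n + 1) + ((n : ℚ) + 1) ^ 3 * den n = 0 := by
  have h := sum_cert n (n + 2)
  have e0 := sum_lam_mul (fun _ => 1) n 2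
  have e1 := sum_lam_mul (fun _ => 1) (n + 1) 1
  simp only [mul_one] at e0 e1
  rw [Finset.sum_add_distrib, Finset.sum_sub_distrib, ← Finset.mul_sum, ← Finset.mul_sum,
    ← Finset.mul_sum, cert, lam_eq_zero (show n + 1 < n + 2 by omega)] at h
  simp only [den]
  rw [← e0, ← e1]
  simpa using h

/-- The correction term in the Zeilberger certificate for the numerators. -/
def corr (n k : ℕ) : ℚ :=
  5 * (2 * (n : ℚ) + 1) * (-1) ^ (k + 1) * k / (n * (n + 1)) * lam n k

lemma sum_cert_approx (n K : ℕ) (hK : K ≤ n + 1) :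
    ∑ k ∈ Finset.range (K + 1), (((n : ℚ) + 2) ^ 3 * (lam (n + 2) k ^ 2 * approx (n + 2) k)
      - coeff n * (lam (n + 1) k ^ 2 * approx (n + 1) k)
      + ((n : ℚ) + 1) ^ 3 * (lam n k ^ 2 * approx n k))
      = cert (n + 1) K * approx (n + 1) K + corr (n + 1) K := by
  have hn1 : (n : ℚ) + 1 ≠ 0 := by positivity
  have hn2 : (n : ℚ) + 2 ≠ 0 := by positivity
  induction K with
  | zero =>
    simp [lam_zero_right, coeff, cert, corr, approx, Finset.sum_range_succ]
    have hn2' : (n : ℚ) + 1 + 1 ≠ 0 := by positivity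
    field_simp
    ring
  | succ k ih =>
    rw [Finset.sum_range_succ, ih (by omega)]
    obtain ⟨μ, h1, h2, h3, h4⟩ := lam_eqs n k
    have hk : k ≤ n := by omega
    have hk' : (n : ℚ) + 1 - k ≠ 0 := by
      have : (k : ℚ) ≤ n := by exact_mod_cast hk
      linarith
    have hk1 : (k : ℚ) + 1 ≠ 0 := by positivity
    have hnk2 : (n : ℚ) + k + 2 ≠ 0 := by positivity
    have hnk3 : (n : ℚ) + k + 3 ≠ 0 := by positivity
    have hμ : μ ≠ 0 := by
      rintro rfl
      have := lam_pos (show k ≤ n + 1 by omega)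
      rw [h1] at this
      simp at this
    have c1 : approx (n + 1) k
        = approx (n + 1) (k + 1) - (-1) ^ k / (2 * ((k : ℚ) + 1) ^ 3 * lam (n + 1) (k + 1)) := by
      rw [approx_succ_right]
      ring
    have c2 : approx (n + 2) (k + 1) = approx (n + 1) (k + 1)
        + (-1) ^ (k + 1) / (((n : ℚ) + 2) ^ 2 * (n + k + 3) * lam (n + 1) (k + 1)) := by
      have := approx_succ_left (show k + 1 ≤ n + 1 by omega)
      push_cast at this
      rw [eq_add_of_sub_eq' this]
      ring
    have c3 : lam n (k + 1) ^ 2 * approx n (k + 1) = lam n (k + 1) ^ 2 * approx (n + 1) (k + 1)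
        - lam n (k + 1) * ((-1) ^ (k + 1) / (((n : ℚ) + 1) ^ 2 * (n + k + 2))) := by
      rcases Nat.lt_or_ge n (k + 1) with h | h
      · simp [lam_eq_zero h]
      have := approx_succ_left h
      push_cast at this
      rw [eq_add_of_sub_eq' this]
      have := (lam_pos h).ne'
      have hnk2' : (n : ℚ) + 1 + (k + 1) ≠ 0 := by positivity
      field_simp
      ring
    rw [c3, c2, c1]
    generalize approx (n + 1) (k + 1) = C
    simp only [cert, corr, coeff, h1, h2, h3, h4]
    rw [pow_succ (-1 : ℚ) (k + 1), pow_succ (-1 : ℚ) k]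
    generalize (-1 : ℚ) ^ k = ε
    push_cast
    have hn2' : (n : ℚ) + 1 + 1 ≠ 0 := by positivity
    field_simp
    ring

lemma num_recurrence (n : ℕ) :
    ((n : ℚ) + 2) ^ 3 * num (n + 2) - coeff n * num (n + 1) + ((n : ℚ) + 1) ^ 3 * num n = 0 := by
  have h := sum_cert_approx n (n + 1) le_rfl
  have e0 := sum_lam_mul (approx n) n 1
  rw [Finset.sum_add_distrib, Finset.sum_sub_distrib, ← Finset.mul_sum, ← Finset.mul_sum,
    ← Finset.mul_sum] at h
  simp only [num]
  rw [Finset.sum_range_succ _ (n + 2), ← e0, mul_add]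
  suffices hs : ((n : ℚ) + 2) ^ 3 * (lam (n + 2) (n + 2) ^ 2 * approx (n + 2) (n + 2))
      = -(cert (n + 1) (n + 1) * approx (n + 1) (n + 1) + corr (n + 1) (n + 1)) by
    linear_combination h + hs
  have hn1 : (n : ℚ) + 1 ≠ 0 := by positivity
  have hn2 : (n : ℚ) + 2 ≠ 0 := by positivity
  have c2 := approx_succ_left (le_refl (n + 1))
  have e2 := lam_succ_right (n + 2) (n + 1)
  have e3 := lam_succ_left (n + 1) (n + 1)
  have p := (lam_pos (le_refl (n + 1))).ne'
  rw [approx_succ_right, eq_add_of_sub_eq' c2]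
  push_cast at e2 e3 ⊢
  have hl : lam (n + 2) (n + 2)
      = lam (n + 1) (n + 1) * (2 * n + 3) * 2 / (n + 2) := by
    field_simp
    have : lam (n + 2) (n + 1) = lam (n + 1) (n + 1) * (2 * n + 3) := by linear_combination e3
    rw [this] at e2
    exact mul_left_cancel₀ hn2 (by linear_combination e2)
  rw [show n + 1 + 1 = n + 2 from rfl, hl]
  simp only [cert, corr]
  rw [pow_succ (-1 : ℚ) (n + 1), pow_succ (-1 : ℚ) n]
  generalize (-1 : ℚ) ^ n = ε
  generalize approx (n + 1) (n + 1) = C at *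
  push_cast
  have hn2' : (n : ℚ) + 1 + 1 ≠ 0 := by positivity
  have hn3 : 2 * (n : ℚ) + 3 ≠ 0 := by positivity
  have hn3' : (n : ℚ) + 1 + 1 + (n + 1) ≠ 0 := by positivity
  field_simp
  ring

lemma den_pos (n : ℕ) : 0 < den n :=
  Finset.sum_pos (fun k hk => pow_pos (lam_pos (by simp at hk; omega)) 2) (by simp)

lemma casoratian (n : ℕ) :
    num (n + 1) * den n - num n * den (n + 1) = 6 / ((n : ℚ) + 1) ^ 3 := by
  induction n with
  | zero =>
    simp [num, den, lam, approx, Finset.sum_range_succ]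
    norm_num
  | succ n ih =>
    have h1 := den_recurrence n
    have h2 := num_recurrence n
    have hn1 : (n : ℚ) + 1 ≠ 0 := by positivity
    have hn2 : (n : ℚ) + 2 ≠ 0 := by positivity
    have hn2' : (n : ℚ) + 1 + 1 ≠ 0 := by positivity
    push_cast
    rw [eq_div_iff (by positivity)] at ih ⊢
    linear_combination den (n + 1) * h2 - num (n + 1) * h1 + ih

lemma den_growth (n : ℕ) (hn : 12 ≤ n) : 30 * den n ≤ den (n + 1) := by
  induction n, hn using Nat.le_induction with
  | base =>
    simp only [den, lam, Finset.sum_range_succ, Finset.sum_range_zero]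
    norm_num [Nat.choose]
  | succ n hn ih =>
    have h := den_recurrence n
    have hp := den_pos (n + 1)
    have hn' : (12 : ℚ) ≤ n := by exact_mod_cast hn
    have h3 : (0 : ℚ) < ((n : ℚ) + 2) ^ 3 := by positivity
    have key : 30 * ((n : ℚ) + 2) ^ 3 + ((n : ℚ) + 1) ^ 3 / 30 ≤ coeff n := by
      unfold coeff
      obtain ⟨x, hx, hx0⟩ : ∃ x : ℚ, (n : ℚ) = 12 + x ∧ 0 ≤ x := ⟨n - 12, by ring, by linarith⟩
      rw [hx]
      have := pow_nonneg hx0 2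
      have := pow_nonneg hx0 3
      nlinarith
    have h4 : ((n : ℚ) + 1) ^ 3 * den n ≤ ((n : ℚ) + 1) ^ 3 / 30 * den (n + 1) := by
      have : (0 : ℚ) < ((n : ℚ) + 1) ^ 3 := by positivity
      nlinarith
    have h5 := mul_le_mul_of_nonneg_right key hp.le
    have h6 : ((n : ℚ) + 2) ^ 3 * (30 * den (n + 1)) ≤ ((n : ℚ) + 2) ^ 3 * den (n + 2) := by
      nlinarith
    exact le_of_mul_le_mul_left h6 h3

lemma den_lower_bound (n : ℕ) : (30 : ℚ) ^ n ≤ 30 ^ 12 * den n := by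
  have h1 : ∀ n, 1 ≤ den n := fun n => by
    have := Finset.single_le_sum (f := fun k => lam n k ^ 2) (s := Finset.range (n + 1))
      (fun k _ => sq_nonneg _) (Finset.mem_range.2 (Nat.succ_pos n))
    simpa [lam_zero_right, den] using this
  rcases le_total n 12 with h | h
  · calc (30 : ℚ) ^ n ≤ 30 ^ 12 * 1 := by
          rw [mul_one]; exact pow_le_pow_right₀ (by norm_num) h
      _ ≤ _ := by gcongr; exact h1 n
  · induction n, h using Nat.le_induction with
    | base => linarith [h1 12]
    | succ n hn ih =>
      have := den_growth n hn
      rw [pow_succ]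
      linarith

lemma lam_mono (n k : ℕ) : lam n k ≤ lam (n + 1) k := by
  unfold lam
  have h1 : n.choose k ≤ (n + 1).choose k := Nat.choose_le_choose k (Nat.le_succ n)
  have h2 : (n + k).choose k ≤ (n + 1 + k).choose k := Nat.choose_le_choose k (by omega)
  gcongr

lemma den_mono : Monotone den := by
  refine monotone_nat_of_le_succ fun n => ?_
  calc den n ≤ ∑ k ∈ Finset.range (n + 1), lam (n + 1) k ^ 2 :=
        Finset.sum_le_sum fun k _ => pow_le_pow_left₀ (lam_nonneg n k) (lam_mono n k) 2
    _ ≤ den (n + 1) := Finset.sum_le_sum_of_subset_of_nonneg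
        (Finset.range_mono (by omega)) fun k _ _ => sq_nonneg _

lemma quotient_step (n : ℕ) :
    num (n + 1) / den (n + 1) - num n / den n = 6 / (((n : ℚ) + 1) ^ 3 * den n * den (n + 1)) := by
  have h := casoratian n
  have h1 := (den_pos n).ne'
  have h2 := (den_pos (n + 1)).ne'
  have hn1 : (n : ℚ) + 1 ≠ 0 := by positivity
  field_simp at h ⊢
  linear_combination h

/-- Partial sums of `ζ(3)`. -/
def zsum (n : ℕ) : ℚ := ∑ m ∈ Finset.range n, 1 / ((m : ℚ) + 1) ^ 3

lemma zsum_mono : Monotone zsum := by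
  refine monotone_nat_of_le_succ fun n => ?_
  rw [zsum, zsum, Finset.sum_range_succ]
  have : (0 : ℚ) ≤ 1 / ((n : ℚ) + 1) ^ 3 := by positivity
  linarith

lemma quotient_sub_le (n j : ℕ) :
    num (n + j) / den (n + j) - num n / den n ≤ 6 / den n ^ 2 * (zsum (n + j) - zsum n) := by
  induction j with
  | zero => simp
  | succ j ih =>
    have h := quotient_step (n + j)
    have hz : zsum (n + j + 1) = zsum (n + j) + 1 / (((n + j : ℕ) : ℚ) + 1) ^ 3 := by
      rw [zsum, zsum, Finset.sum_range_succ]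
    rw [← add_assoc, hz]
    have h0 := den_pos n
    have hle : 6 / ((((n + j : ℕ) : ℚ) + 1) ^ 3 * den (n + j) * den (n + j + 1))
        ≤ 6 / den n ^ 2 * (1 / (((n + j : ℕ) : ℚ) + 1) ^ 3) := by
      rw [div_mul_div_comm, mul_one]
      have h1 := den_mono (show n ≤ n + j by omega)
      have h2 := den_mono (show n ≤ n + j + 1 by omega)
      have h3 := den_pos (n + j)
      refine div_le_div_of_nonneg_left (by norm_num) (by positivity) ?_
      calc den n ^ 2 * (((n + j : ℕ) : ℚ) + 1) ^ 3
          = (((n + j : ℕ) : ℚ) + 1) ^ 3 * (den n * den n) := by ring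
        _ ≤ (((n + j : ℕ) : ℚ) + 1) ^ 3 * (den (n + j) * den (n + j + 1)) := by gcongr
        _ = _ := by ring
    linarith

lemma quotient_strictMono : StrictMono fun n => num n / den n := by
  refine strictMono_nat_of_lt_succ fun n => ?_
  have h := quotient_step n
  have h1 := den_pos n
  have h2 := den_pos (n + 1)
  have : 0 < 6 / (((n : ℚ) + 1) ^ 3 * den n * den (n + 1)) := by positivity
  linarith

lemma zsum_le_two (n : ℕ) : zsum n ≤ 2 := by
  have h : ∀ n : ℕ, zsum (n + 1) ≤ 2 - 1 / ((n : ℚ) + 1) := fun n => by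
    induction n with
    | zero => norm_num [zsum]
    | succ n ih =>
      rw [zsum, Finset.sum_range_succ, ← zsum]
      have : 1 / (((n + 1 : ℕ) : ℚ) + 1) ^ 3 ≤ 1 / ((n : ℚ) + 1) - 1 / (((n + 1 : ℕ) : ℚ) + 1) := by
        push_cast
        rw [div_sub_div _ _ (by positivity) (by positivity),
          div_le_div_iff₀ (by positivity) (by positivity)]
        have : (0 : ℚ) ≤ n := by positivity
        nlinarith [pow_nonneg this 2, pow_nonneg this 3]
      linarith
  refine (zsum_mono (Nat.le_succ n)).trans ((h n).trans ?_)
  have : (0 : ℚ) ≤ 1 / ((n : ℚ) + 1) := by positivity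
  linarith

lemma abs_approx_sub_le (n k : ℕ) (h : k ≤ n) : |approx n k - zsum n| ≤ 1 / ((n : ℚ) + 1) := by
  have h1 : approx n k - zsum n
      = ∑ m ∈ Finset.range k, (-1) ^ m / (2 * ((m : ℚ) + 1) ^ 3 * lam n (m + 1)) := by
    simp [approx, zsum]
  rw [h1]
  refine (Finset.abs_sum_le_sum_abs _ _).trans ?_
  have h2 : ∀ m ∈ Finset.range k, |(-1) ^ m / (2 * ((m : ℚ) + 1) ^ 3 * lam n (m + 1))|
      ≤ 1 / ((m : ℚ) + 1) ^ 3 * (1 / (2 * ((n : ℚ) + 1))) := fun m hm => by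
    have hm' : m + 1 ≤ n := by simp at hm; omega
    have hl : (n : ℚ) + 1 ≤ lam n (m + 1) := by
      unfold lam
      have a1 : 1 ≤ n.choose (m + 1) := Nat.choose_pos hm'
      have a2 : n + 1 ≤ (n + (m + 1)).choose (m + 1) := by
        calc n + 1 = (n + 1).choose n := by simp
          _ ≤ (n + (m + 1)).choose n := Nat.choose_le_choose n (by omega)
          _ = _ := Nat.choose_symm_add
      have : n + 1 ≤ n.choose (m + 1) * (n + (m + 1)).choose (m + 1) := by nlinarith
      exact_mod_cast this
    have hl0 : (0 : ℚ) < lam n (m + 1) := lam_pos hm'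
    rw [abs_div, abs_pow, abs_neg, abs_one, one_pow, abs_of_pos (by positivity), div_mul_div_comm,
      mul_one]
    apply one_div_le_one_div_of_le (by positivity)
    calc ((m : ℚ) + 1) ^ 3 * (2 * (n + 1)) = 2 * ((m : ℚ) + 1) ^ 3 * (n + 1) := by ring
      _ ≤ _ := by gcongr
  refine (Finset.sum_le_sum h2).trans ?_
  rw [← Finset.sum_mul, ← zsum]
  calc zsum k * (1 / (2 * ((n : ℚ) + 1))) ≤ 2 * (1 / (2 * ((n : ℚ) + 1))) := by
        gcongr
        exact zsum_le_two k
    _ = _ := by field_simp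

lemma abs_quotient_sub_le (n : ℕ) : |num n / den n - zsum n| ≤ 1 / ((n : ℚ) + 1) := by
  have h := den_pos n
  have h1 : num n / den n - zsum n
      = (∑ k ∈ Finset.range (n + 1), lam n k ^ 2 * (approx n k - zsum n)) / den n := by
    rw [eq_div_iff h.ne', sub_mul, div_mul_cancel₀ _ h.ne']
    simp only [mul_sub, Finset.sum_sub_distrib, ← Finset.sum_mul, num, den]
    ring
  rw [h1, abs_div, abs_of_pos h, div_le_iff₀ h]
  refine (Finset.abs_sum_le_sum_abs _ _).trans ?_
  rw [den, Finset.mul_sum]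
  refine Finset.sum_le_sum fun k hk => ?_
  rw [abs_mul, abs_of_nonneg (sq_nonneg _), mul_comm]
  exact mul_le_mul_of_nonneg_right
    (abs_approx_sub_le n k (by simp at hk; omega)) (sq_nonneg _)


open Filter Topology

section
variable {z : ℝ}

lemma tendsto_zsum (hz : HasSum (fun n : ℕ => 1 / ((n : ℝ) + 1) ^ 3) z) :
    Tendsto (fun n => (zsum n : ℝ)) atTop (𝓝 z) := by
  have := hz.tendsto_sum_nat
  simpa [zsum] using this

lemma tendsto_quotient (hz : HasSum (fun n : ℕ => 1 / ((n : ℝ) + 1) ^ 3) z) :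
    Tendsto (fun n => ((num n / den n : ℚ) : ℝ)) atTop (𝓝 z) := by
  have h1 : Tendsto (fun n => ((num n / den n : ℚ) : ℝ) - (zsum n : ℝ)) atTop (𝓝 0) := by
    refine squeeze_zero_norm (fun n => ?_) (tendsto_one_div_add_atTop_nhds_zero_nat (𝕜 := ℝ))
    have h := (Rat.cast_le (K := ℝ)).2 (abs_quotient_sub_le n)
    push_cast at h ⊢
    exact h
  simpa using h1.add (tendsto_zsum hz)

lemma quotient_lt (hz : HasSum (fun n : ℕ => 1 / ((n : ℝ) + 1) ^ 3) z) (n : ℕ) :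
    ((num n / den n : ℚ) : ℝ) < z := by
  have h1 : ((num n / den n : ℚ) : ℝ) < ((num (n + 1) / den (n + 1) : ℚ) : ℝ) := by
    exact_mod_cast quotient_strictMono (Nat.lt_succ_self n)
  refine h1.trans_le (ge_of_tendsto (tendsto_quotient hz) ?_)
  filter_upwards [eventually_ge_atTop (n + 1)] with m hm
  exact_mod_cast quotient_strictMono.monotone hm

lemma sub_quotient_le (hz : HasSum (fun n : ℕ => 1 / ((n : ℝ) + 1) ^ 3) z) (n : ℕ) :
    z - ((num n / den n : ℚ) : ℝ) ≤ 12 / (den n : ℝ) ^ 2 := by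
  refine le_of_tendsto ((tendsto_quotient hz).sub_const _) ?_
  filter_upwards [eventually_ge_atTop n] with m hm
  obtain ⟨j, rfl⟩ := Nat.exists_eq_add_of_le hm
  have h1 := quotient_sub_le n j
  have h2 : zsum (n + j) - zsum n ≤ 2 := by
    have h3 := zsum_le_two (n + j)
    have h4 : 0 ≤ zsum n := Finset.sum_nonneg fun _ _ => by positivity
    linarith
  have h3 : num (n + j) / den (n + j) - num n / den n ≤ 12 / den n ^ 2 := by
    refine h1.trans ?_
    have := den_pos n
    calc 6 / den n ^ 2 * (zsum (n + j) - zsum n) ≤ 6 / den n ^ 2 * 2 := by gcongr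
      _ = _ := by ring
  exact_mod_cast h3

end

/-- The integers as a subring of the rationals. -/
abbrev ints : Subring ℚ := (Int.castRingHom ℚ).range

lemma natCast_mem_ints (n : ℕ) : (n : ℚ) ∈ ints := ⟨n, by simp⟩

lemma div_mem_ints {D i : ℕ} (h : i ∣ D) (hi : i ≠ 0) : (D : ℚ) / i ∈ ints := by
  obtain ⟨c, rfl⟩ := h
  have : (i : ℚ) ≠ 0 := by exact_mod_cast hi
  rw [Nat.cast_mul, mul_div_cancel_left₀ _ this]
  exact natCast_mem_ints c

lemma div_mul_choose_mem_ints (D m n : ℕ) (hm : m < n) (hD : ∀ i, 1 ≤ i → i ≤ n → i ∣ D) :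
    (D : ℚ) / ((m + 1) * n.choose (m + 1)) ∈ ints := by
  induction m generalizing n with
  | zero => simpa using div_mem_ints (hD n (by omega) le_rfl) (by omega)
  | succ m ih =>
    obtain ⟨n, rfl⟩ : ∃ k, n = k + 1 := ⟨n - 1, by omega⟩
    have h1 := ih n (by omega) fun i h h' => hD i h (by omega)
    have h2 := ih (n + 1) (by omega) hD
    convert sub_mem h1 h2 using 1
    have c0 : (n.choose (m + 1) : ℚ) ≠ 0 := by
      exact_mod_cast (Nat.choose_pos (by omega)).ne'
    have e1 : ((n + 1).choose (m + 1) : ℚ) * (n - m) = n.choose (m + 1) * (n + 1) := by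
      have := Nat.choose_mul_succ_eq n (m + 1)
      rw [show n + 1 - (m + 1) = n - m by omega] at this
      rw [← Nat.cast_sub (by omega)]
      exact_mod_cast this.symm
    have e2 : ((n + 1).choose (m + 2) : ℚ) * (m + 2) = (n + 1) * n.choose (m + 1) := by
      have := Nat.add_one_mul_choose_eq n (m + 1)
      exact_mod_cast this.symm
    have hnm : (n : ℚ) - m ≠ 0 := by
      have : (m : ℚ) + 1 < n + 1 := by exact_mod_cast hm
      linarith
    have e1' : ((n + 1).choose (m + 1) : ℚ) = n.choose (m + 1) * (n + 1) / (n - m) := by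
      rw [eq_div_iff hnm, e1]
    have e2' : ((n + 1).choose (m + 2) : ℚ) = (n + 1) * n.choose (m + 1) / (m + 2) := by
      rw [eq_div_iff (by positivity), e2]
    rw [show m + 1 + 1 = m + 2 from rfl, e1', e2']
    push_cast
    have : (m : ℚ) + 1 + 1 ≠ 0 := by positivity
    field_simp
    ring

lemma lam_mem_ints (n k : ℕ) : lam n k ∈ ints :=
  mul_mem (natCast_mem_ints _) (natCast_mem_ints _)

lemma den_mem_ints (n : ℕ) : den n ∈ ints :=
  sum_mem fun k _ => pow_mem (lam_mem_ints n k) 2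

lemma mul_approx_mem_ints (D n k : ℕ) (hk : k ≤ n) (hD : ∀ i, 1 ≤ i → i ≤ n → i ∣ D) :
    2 * (D : ℚ) ^ 3 * (lam n k ^ 2 * approx n k) ∈ ints := by
  rw [approx, mul_add, mul_add]
  have two : (2 : ℚ) ∈ ints := natCast_mem_ints 2
  refine add_mem ?_ ?_
  · rw [Finset.mul_sum, Finset.mul_sum]
    refine sum_mem fun m hm => ?_
    have h := div_mem_ints (hD (m + 1) (by omega) (by simp at hm; omega)) (by omega)
    convert mul_mem (mul_mem two (pow_mem (lam_mem_ints n k) 2)) (pow_mem h 3) using 1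
    push_cast
    have : (m : ℚ) + 1 ≠ 0 := by positivity
    field_simp
  · rw [Finset.mul_sum, Finset.mul_sum]
    refine sum_mem fun m hm => ?_
    have hm : m + 1 ≤ k := by simp at hm; omega
    have h1 := div_mem_ints (hD (m + 1) (by omega) (by omega)) (by omega)
    have h2 := div_mul_choose_mem_ints D m n (by omega) hD
    have h3 := div_mul_choose_mem_ints D m k (by omega) fun i h h' => hD i h (by omega)
    have e : (n + k).choose (n + (m + 1)) * (n + (m + 1)).choose (m + 1)
        = (n + k).choose k * k.choose (m + 1) := by
      have := Nat.choose_mul (n := n + k) (k := n + (m + 1)) (s := n)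
      rw [show n + k - n = k by omega, show n + (m + 1) - n = m + 1 by omega,
        Nat.choose_symm_add, Nat.choose_symm_add] at this
      exact this (by omega)
    have e' : ((n + k).choose (n + (m + 1)) : ℚ) * (n + (m + 1)).choose (m + 1)
        = (n + k).choose k * k.choose (m + 1) := by exact_mod_cast e
    convert mul_mem (mul_mem (mul_mem (pow_mem (neg_mem (one_mem ints)) m)
      (mul_mem (lam_mem_ints n k) (natCast_mem_ints (n.choose k))))
      (mul_mem (natCast_mem_ints ((n + k).choose (n + (m + 1)))) h1)) (mul_mem h2 h3) using 1
    have c1 : (n.choose (m + 1) : ℚ) ≠ 0 := by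
      exact_mod_cast (Nat.choose_pos (by omega)).ne'
    have c2 : (k.choose (m + 1) : ℚ) ≠ 0 := by
      exact_mod_cast (Nat.choose_pos (by omega)).ne'
    have c3 : ((n + (m + 1)).choose (m + 1) : ℚ) ≠ 0 := by
      exact_mod_cast (Nat.choose_pos (by omega)).ne'
    have hm1 : (m : ℚ) + 1 ≠ 0 := by positivity
    simp only [lam]
    push_cast
    field_simp
    linear_combination (-(D : ℚ) ^ 3 * n.choose k ^ 2 * (n + k).choose k) * e'

lemma mul_num_mem_ints (D n : ℕ) (hD : ∀ i, 1 ≤ i → i ≤ n → i ∣ D) :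
    2 * (D : ℚ) ^ 3 * num n ∈ ints := by
  rw [num, Finset.mul_sum]
  exact sum_mem fun k hk => mul_approx_mem_ints D n k (by simp at hk; omega) hD

section
open Nat

lemma lcmUpto_mul_factorials_dvd (m : ℕ) :
    lcmUpto (42 * m) * ((21 * m)! * (14 * m)! * (6 * m)! * m !) ∣ (42 * m)! * lcmUpto m := by
  have f := Nat.factorial_ne_zero
  have g := lcmUpto_ne_zero
  rw [← Nat.factorization_prime_le_iff_dvd (by simp [f, g]) (by simp [f, g])]
  intro p hp
  rw [Nat.factorization_mul (by simp [g]) (by simp [f]),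
    Nat.factorization_mul (by simp [f]) (by simp [f]),
    Nat.factorization_mul (by simp [f]) (by simp [f]),
    Nat.factorization_mul (by simp [f]) (by simp [f]),
    Nat.factorization_mul (by simp [f]) (by simp [g])]
  simp only [Finsupp.add_apply, Nat.factorization_lcmUpto _ hp]
  set b := 42 * m + 1 with hb
  have hlog : ∀ n, n ≤ 42 * m → Nat.log p n < b := fun n hn =>
    (Nat.log_le_self p n).trans_lt (by omega)
  have hlog' : ∀ n, n ≤ 42 * m →
      Nat.log p n = ∑ i ∈ Finset.Ico 1 b, if 1 ≤ n / p ^ i then 1 else 0 := fun n hn => by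
    rw [← Finset.card_filter]
    have : (Finset.Ico 1 b).filter (fun i => 1 ≤ n / p ^ i) = Finset.Ico 1 (Nat.log p n + 1) := by
      ext i
      have := hlog n hn
      have hpi : 0 < p ^ i := pow_pos hp.pos i
      simp only [Finset.mem_filter, Finset.mem_Ico, Nat.one_le_div_iff hpi]
      rcases Nat.eq_zero_or_pos n with rfl | hn0
      · simp [hp.ne_zero]
        omega
      · rw [← Nat.le_log_iff_pow_le hp.one_lt hn0.ne']
        omega
    rw [this]
    simp
  rw [Nat.factorization_factorial hp (hlog _ (by omega)),
    Nat.factorization_factorial hp (hlog _ (by omega)),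
    Nat.factorization_factorial hp (hlog _ (by omega)),
    Nat.factorization_factorial hp (hlog _ (by omega)),
    Nat.factorization_factorial hp (hlog _ (by omega)), hlog' _ le_rfl, hlog' m (by omega)]
  simp only [← Finset.sum_add_distrib]
  refine Finset.sum_le_sum fun i _ => ?_
  have e : ∀ a c, a * c = 42 → (a * m) / p ^ i = (42 * m / p ^ i) / c := fun a c h => by
    have hc : 0 < c := Nat.pos_of_ne_zero (by rintro rfl; simp at h)
    rw [Nat.div_div_eq_div_mul, ← h, mul_right_comm, Nat.mul_div_mul_right _ _ hc]
  have e1 := e 21 2 rfl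
  have e2 := e 14 3 rfl
  have e3 := e 6 7 rfl
  have e4 := e 1 42 rfl
  rw [one_mul] at e4
  rw [e1, e2, e3, e4]
  generalize 42 * m / p ^ i = t
  split_ifs <;> omega

lemma factorial_le_mul_factorials (m : ℕ) :
    (42 * m)! ≤ (2 ^ 22 * 3 ^ 15 * 7 ^ 7) ^ m * ((21 * m)! * (14 * m)! * (6 * m)! * m !) := by
  have h1 : (42 * m).choose (21 * m) ≤ 2 ^ (42 * m) := Nat.choose_le_two_pow _ _
  have key : ∀ N k x : ℕ, k ≤ N → x ^ k * N.choose k ≤ (x + 1) ^ N := fun N k x h => by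
    rw [add_pow]
    have := Finset.single_le_sum (f := fun i => x ^ i * 1 ^ (N - i) * N.choose i)
      (s := Finset.range (N + 1)) (fun _ _ => by positivity) (Finset.mem_range.2 (by omega : k < N + 1))
    simpa using this
  have h2 := key (21 * m) (14 * m) 2 (by omega)
  have h3 := key (7 * m) (6 * m) 6 (by omega)
  have c1 := Nat.choose_mul_factorial_mul_factorial (show 21 * m ≤ 42 * m by omega)
  have c2 := Nat.choose_mul_factorial_mul_factorial (show 14 * m ≤ 21 * m by omega)
  have c3 := Nat.choose_mul_factorial_mul_factorial (show 6 * m ≤ 7 * m by omega)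
  rw [show 42 * m - 21 * m = 21 * m by omega] at c1
  rw [show 21 * m - 14 * m = 7 * m by omega] at c2
  rw [show 7 * m - 6 * m = m by omega] at c3
  have hpos : 0 < 2 ^ (14 * m) * 6 ^ (6 * m) := by positivity
  refine le_of_mul_le_mul_left ?_ hpos
  calc 2 ^ (14 * m) * 6 ^ (6 * m) * (42 * m)!
      = ((42 * m).choose (21 * m)) * (2 ^ (14 * m) * (21 * m).choose (14 * m)) *
        (6 ^ (6 * m) * (7 * m).choose (6 * m)) * ((21 * m)! * (14 * m)! * (6 * m)! * m !) := by
        have : (42 * m)! = (42 * m).choose (21 * m) * ((21 * m).choose (14 * m) * (14 * m)! *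
            ((7 * m).choose (6 * m) * (6 * m)! * m !)) * (21 * m)! := by rw [c3, c2, c1]
        rw [this]
        ring
    _ ≤ 2 ^ (42 * m) * (2 + 1) ^ (21 * m) * (6 + 1) ^ (7 * m)
        * ((21 * m)! * (14 * m)! * (6 * m)! * m !) := by gcongr
    _ = _ := by
        rw [← mul_assoc (2 ^ (14 * m) * 6 ^ (6 * m))]
        congr 1
        simp only [pow_mul, ← mul_pow]
        norm_num

lemma lcmUpto_le (m : ℕ) :
    lcmUpto (42 * m) ≤ (2 ^ 22 * 3 ^ 15 * 7 ^ 7) ^ m * lcmUpto m := by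
  have h1 := Nat.le_of_dvd (Nat.mul_pos (Nat.factorial_pos _) (lcmUpto_pos m))
    (lcmUpto_mul_factorials_dvd m)
  have hpos : 0 < (21 * m)! * (14 * m)! * (6 * m)! * m ! := by positivity
  refine le_of_mul_le_mul_right ?_ hpos
  calc _ ≤ (42 * m)! * lcmUpto m := h1
    _ ≤ _ := by
      grw [factorial_le_mul_factorials m]
      exact le_of_eq (by ring)

lemma lcmUpto_le_five_pow : ∀ᶠ m : ℕ in atTop, (lcmUpto m : ℝ) ≤ 5 ^ m := by
  have hlog : 0 < Real.log 5 - Real.log 4 :=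
    sub_pos.2 (Real.log_lt_log (by norm_num) (by norm_num))
  have h : (fun x : ℝ => Real.log x) =o[atTop] fun x => x ^ (1 / 2 : ℝ) :=
    isLittleO_log_rpow_atTop (by norm_num)
  have h2 := (h.bound (half_pos hlog))
  filter_upwards [tendsto_natCast_atTop_atTop.eventually h2, eventually_ge_atTop 1] with m hm hm1
  have hm1' : (1 : ℝ) ≤ m := by exact_mod_cast hm1
  have h3 := Chebyshev.psi_le hm1'
  rw [Chebyshev.psi_eq_log_lcmUpto] at h3
  have hl : 0 < (lcmUpto m : ℝ) := by exact_mod_cast lcmUpto_pos m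
  rw [← Real.log_le_log_iff hl (by positivity), Real.log_pow]
  rw [← Real.sqrt_eq_rpow, Real.norm_of_nonneg (Real.log_nonneg hm1'),
    Real.norm_of_nonneg (Real.sqrt_nonneg _)] at hm
  have h4 : 2 * √(m : ℝ) * Real.log m ≤ (Real.log 5 - Real.log 4) * m := by
    calc 2 * √(m : ℝ) * Real.log m
        ≤ 2 * √(m : ℝ) * ((Real.log 5 - Real.log 4) / 2 * √(m : ℝ)) := by gcongr
      _ = (Real.log 5 - Real.log 4) * (√(m : ℝ) * √(m : ℝ)) := by ring
      _ = _ := by rw [Real.mul_self_sqrt (by positivity)]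
  linarith

end


section
variable {z : ℝ}

/-- Apéry's theorem: `ζ(3)` is irrational. -/
theorem irrational_of_hasSum (hz : HasSum (fun n : ℕ => 1 / ((n : ℝ) + 1) ^ 3) z) :
    Irrational z := by
  rintro ⟨q, hq⟩
  have hb : (q.den : ℝ) ≠ 0 := by exact_mod_cast q.den_nz
  set K : ℝ := 2 ^ 22 * 3 ^ 15 * 7 ^ 7 with hK
  have lower : ∀ m : ℕ, 1 ≤ 24 * q.den * (Nat.lcmUpto (42 * m) : ℝ) ^ 3 / den (42 * m) := by
    intro m
    set n := 42 * m
    set D := Nat.lcmUpto n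
    have hD : ∀ i, 1 ≤ i → i ≤ n → i ∣ D := fun i h1 h2 =>
      Finset.dvd_lcm (f := id) (Finset.mem_Icc.2 ⟨h1, h2⟩)
    have hpos := den_pos n
    have hDpos : (0 : ℚ) < D := by exact_mod_cast Nat.lcmUpto_pos n
    have hqd : (0 : ℚ) < q.den := by exact_mod_cast q.den_pos
    have h1 : q - num n / den n > 0 := by
      have := quotient_lt hz n
      rw [← hq] at this
      exact sub_pos.2 (by exact_mod_cast this)
    have h2 : q - num n / den n ≤ 12 / den n ^ 2 := by
      have := sub_quotient_le hz n
      rw [← hq] at this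
      exact_mod_cast this
    have h3 : 2 * (D : ℚ) ^ 3 * q.den * den n * (q - num n / den n) ∈ ints := by
      have e : 2 * (D : ℚ) ^ 3 * q.den * den n * (q - num n / den n)
          = ((2 : ℕ) : ℚ) * (D : ℚ) ^ 3 * den n * q.num - q.den * (2 * (D : ℚ) ^ 3 * num n) := by
        have : q * q.den = q.num := Rat.mul_den_eq_num q
        rw [← this]
        field_simp
        push_cast
        ring
      rw [e]
      exact sub_mem (mul_mem (mul_mem (mul_mem (natCast_mem_ints 2) (pow_mem (natCast_mem_ints D) 3))
        (den_mem_ints n)) ⟨q.num, by simp⟩) (mul_mem (natCast_mem_ints _) (mul_num_mem_ints D n hD))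
    have h4 : 0 < 2 * (D : ℚ) ^ 3 * q.den * den n * (q - num n / den n) := by positivity
    have h5 : 1 ≤ 2 * (D : ℚ) ^ 3 * q.den * den n * (q - num n / den n) := by
      obtain ⟨N, hN⟩ := h3
      rw [← hN] at h4 ⊢
      simp only [eq_intCast] at h4 ⊢
      exact_mod_cast h4
    have h6 : (1 : ℚ) ≤ 24 * q.den * (D : ℚ) ^ 3 / den n := by
      refine h5.trans ?_
      calc _ ≤ 2 * (D : ℚ) ^ 3 * q.den * den n * (12 / den n ^ 2) := by gcongr
        _ = _ := by
          field_simp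
          norm_num
    exact_mod_cast h6
  have hr : (5 * K) ^ 3 / 30 ^ 42 < 1 := by
    rw [hK]
    norm_num
  have lim : Tendsto (fun m : ℕ => 24 * q.den * 30 ^ 12 * ((5 * K) ^ 3 / 30 ^ 42) ^ m)
      atTop (𝓝 0) := by
    simpa using (tendsto_pow_atTop_nhds_zero_of_lt_one (by positivity) hr).const_mul
      (24 * (q.den : ℝ) * 30 ^ 12)
  obtain ⟨m, hm1, hm2⟩ := ((lim.eventually_lt_const one_pos).and lcmUpto_le_five_pow).exists
  refine absurd (lower m) (not_le.2 (lt_of_le_of_lt ?_ hm1))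
  have h1 : (Nat.lcmUpto (42 * m) : ℝ) ≤ (5 * K) ^ m := by
    have : (Nat.lcmUpto (42 * m) : ℝ) ≤ K ^ m * Nat.lcmUpto m := by
      rw [hK]
      exact_mod_cast lcmUpto_le m
    have hK0 : 0 ≤ K ^ m := by positivity
    calc (Nat.lcmUpto (42 * m) : ℝ) ≤ K ^ m * Nat.lcmUpto m := this
      _ ≤ K ^ m * 5 ^ m := mul_le_mul_of_nonneg_left hm2 hK0
      _ = (5 * K) ^ m := by rw [mul_pow 5 K, mul_comm]
  have h2 : (30 : ℝ) ^ (42 * m) ≤ 30 ^ 12 * den (42 * m) := by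
    exact_mod_cast den_lower_bound (42 * m)
  have hpos : (0 : ℝ) < den (42 * m) := by exact_mod_cast den_pos _
  rw [div_le_iff₀ hpos]
  calc 24 * q.den * (Nat.lcmUpto (42 * m) : ℝ) ^ 3
      ≤ 24 * q.den * ((5 * K) ^ m) ^ 3 := by gcongr
    _ = 24 * q.den * ((5 * K) ^ 3 / 30 ^ 42) ^ m * 30 ^ (42 * m) := by
      rw [div_pow, ← pow_mul, ← pow_mul, ← pow_mul, mul_comm m 3]
      field_simp
    _ ≤ 24 * q.den * ((5 * K) ^ 3 / 30 ^ 42) ^ m * (30 ^ 12 * den (42 * m)) := by gcongr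
    _ = _ := by ring

end
end Apery

namespace PiTranscendental
open Polynomial

/-- The sum of the conjugates of `y` under the automorphisms in `S`. -/
def conjSum {L : Type*} [Field L] [Algebra ℚ L] (y : L) (S : Finset (L ≃ₐ[ℚ] L)) : L :=
  ∑ σ ∈ S, σ y

lemma isIntegral_pow_mul_aeval {L : Type*} [Field L] {f g : ℤ[X]} {x : L} (hx : aeval x f = 0) {D : ℕ}
    (hD : g.natDegree ≤ D) : IsIntegral ℤ ((f.leadingCoeff : L) ^ D * aeval x g) := by
  have h : IsIntegral ℤ (f.leadingCoeff • x) := isIntegral_leadingCoeff_smul f x hx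
  rw [aeval_eq_sum_range, Finset.mul_sum]
  refine IsIntegral.sum _ fun i hi => ?_
  have hi' : i ≤ D := by
    have := Finset.mem_range.1 hi
    omega
  have e : (f.leadingCoeff : L) ^ D * (g.coeff i • x ^ i)
      = ((g.coeff i * f.leadingCoeff ^ (D - i) : ℤ) : L) * (f.leadingCoeff • x) ^ i := by
    obtain ⟨j, rfl⟩ := Nat.exists_eq_add_of_le hi'
    simp only [zsmul_eq_mul, mul_pow, pow_add, Nat.add_sub_cancel_left]
    push_cast
    ring
  rw [e]
  exact IsIntegral.mul (isIntegral_algebraMap (R := ℤ)) (h.pow i)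

section
variable {L : Type*} [Field L] [Algebra ℚ L]

/-- Left translation of finite sets of automorphisms. -/
def translate (τ : L ≃ₐ[ℚ] L) : Finset (L ≃ₐ[ℚ] L) ≃ Finset (L ≃ₐ[ℚ] L) :=
  (Equiv.mulLeft τ).finsetCongr

lemma conjSum_translate (y : L) (τ : L ≃ₐ[ℚ] L) (S : Finset (L ≃ₐ[ℚ] L)) :
    conjSum y (translate τ S) = τ (conjSum y S) := by
  simp [conjSum, translate, map_sum]

variable [FiniteDimensional ℚ L]

open Classical in
/-- The sets of automorphisms with non-vanishing sum of conjugates. -/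
noncomputable def nonvanishing (y : L) : Finset (Finset (L ≃ₐ[ℚ] L)) :=
  Finset.univ.filter fun S => conjSum y S ≠ 0

lemma mem_nonvanishing {y : L} {S : Finset (L ≃ₐ[ℚ] L)} :
    S ∈ nonvanishing y ↔ conjSum y S ≠ 0 := by
  simp [nonvanishing]

lemma translate_mem_nonvanishing (y : L) (τ : L ≃ₐ[ℚ] L) (S : Finset (L ≃ₐ[ℚ] L)) :
    S ∈ nonvanishing y ↔ translate τ S ∈ nonvanishing y := by
  simp [mem_nonvanishing, conjSum_translate]

lemma sum_exp (ι : L →ₐ[ℚ] ℂ) (y : L) (hy : Complex.exp (ι y) = -1) :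
    ∃ k : ℕ, 0 < k ∧ ∑ S ∈ nonvanishing y, Complex.exp (ι (conjSum y S)) = -k := by
  classical
  have h1 : ∏ σ : L ≃ₐ[ℚ] L, (1 + Complex.exp (ι (σ y))) = 0 :=
    Finset.prod_eq_zero (Finset.mem_univ 1) (by simp [hy])
  rw [Finset.prod_one_add, Finset.powerset_univ] at h1
  simp only [← Complex.exp_sum, ← map_sum] at h1
  refine ⟨(Finset.univ.filter fun S : Finset (L ≃ₐ[ℚ] L) => ¬ conjSum y S ≠ 0).card,
    Finset.card_pos.2 ⟨∅, by simp [conjSum]⟩, ?_⟩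
  rw [← Finset.sum_filter_add_sum_filter_not _ fun S => conjSum y S ≠ 0] at h1
  rw [nonvanishing, eq_neg_iff_add_eq_zero]
  have h2 : ∑ S ∈ Finset.univ.filter (fun S : Finset (L ≃ₐ[ℚ] L) => ¬ conjSum y S ≠ 0),
      Complex.exp (ι (∑ σ ∈ S, σ y)) = ∑ S ∈ Finset.univ.filter
        (fun S : Finset (L ≃ₐ[ℚ] L) => ¬ conjSum y S ≠ 0), 1 :=
    Finset.sum_congr rfl fun S hS => by
      have : conjSum y S = 0 := by simpa using hS
      rw [conjSum] at this
      simp [this]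
  rw [h2, Finset.sum_const, nsmul_one] at h1
  convert h1 using 3
  rfl

variable [IsGalois ℚ L]

lemma sum_mem_range (y : L) (g : ℚ[X]) :
    ∃ q : ℚ, algebraMap ℚ L q = ∑ S ∈ nonvanishing y, aeval (conjSum y S) g := by
  refine (IsGalois.mem_range_algebraMap_iff_fixed _).2 fun τ => ?_
  rw [map_sum]
  refine Finset.sum_equiv (translate τ) (translate_mem_nonvanishing y τ) fun S _ => ?_
  rw [conjSum_translate]
  exact (aeval_algHom_apply (τ : L →ₐ[ℚ] L) (conjSum y S) g).symm

lemma prod_lifts (y : L) :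
    ∃ Q : ℚ[X], Q.map (algebraMap ℚ L) = ∏ S ∈ nonvanishing y, (X - C (conjSum y S)) := by
  refine (mem_lifts _).1 ((lifts_iff_coeff_lifts _).2 fun n => ?_)
  refine (IsGalois.mem_range_algebraMap_iff_fixed _).2 fun τ => ?_
  have : (∏ S ∈ nonvanishing y, (X - C (conjSum y S))).map (τ : L →+* L)
      = ∏ S ∈ nonvanishing y, (X - C (conjSum y S)) := by
    rw [Polynomial.map_prod]
    refine Finset.prod_equiv (translate τ) (translate_mem_nonvanishing y τ) fun S _ => ?_
    simp [conjSum_translate]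
  conv_rhs => rw [← this, coeff_map]
  rfl

lemma exists_int_polynomial (y : L) :
    ∃ f : ℤ[X], f.eval 0 ≠ 0 ∧ ∀ S ∈ nonvanishing y, aeval (conjSum y S) f = 0 := by
  obtain ⟨Q, hQ⟩ := prod_lifts y
  obtain ⟨a, ha, hf⟩ := IsLocalization.integerNormalization_spec (nonZeroDivisors ℤ) Q
  have key (x : L) : aeval x (IsLocalization.integerNormalization (nonZeroDivisors ℤ) Q)
      = a * ∏ S ∈ nonvanishing y, (x - conjSum y S) := by
    rw [← aeval_map_algebraMap ℚ, hf, map_zsmul, zsmul_eq_mul, ← eval_map_algebraMap, hQ,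
      eval_prod]
    simp
  refine ⟨IsLocalization.integerNormalization (nonZeroDivisors ℤ) Q, fun h0 => ?_, fun S hS => ?_⟩
  · have h := key 0
    rw [← coeff_zero_eq_aeval_zero', coeff_zero_eq_eval_zero, h0, map_zero, eq_comm,
      mul_eq_zero, Finset.prod_eq_zero_iff] at h
    rcases h with h | ⟨S, hS, h⟩
    · have := algebraRat.charZero L
      exact nonZeroDivisors.ne_zero ha (Int.cast_eq_zero.1 h)
    · exact mem_nonvanishing.1 hS (by simpa using h)
  · rw [key, Finset.prod_eq_zero hS (sub_self _), mul_zero]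

lemma exists_int_sum {y : L} {f g : ℤ[X]} (hf : ∀ S ∈ nonvanishing y, aeval (conjSum y S) f = 0)
    {D : ℕ} (hD : g.natDegree ≤ D) :
    ∃ z : ℤ, (z : L) = (f.leadingCoeff : L) ^ D * ∑ S ∈ nonvanishing y, aeval (conjSum y S) g := by
  obtain ⟨q, hq⟩ := sum_mem_range y (g.map (algebraMap ℤ ℚ))
  simp only [aeval_map_algebraMap] at hq
  have h1 : IsIntegral ℤ (algebraMap ℚ L ((f.leadingCoeff : ℚ) ^ D * q)) := by
    rw [map_mul, hq, Finset.mul_sum, map_pow, map_intCast]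
    exact IsIntegral.sum _ fun S hS => isIntegral_pow_mul_aeval (hf S hS) hD
  rw [isIntegral_algebraMap_iff (algebraMap ℚ L).injective] at h1
  obtain ⟨z, hz⟩ := IsIntegrallyClosed.isIntegral_iff.1 h1
  refine ⟨z, ?_⟩
  rw [← hq, ← map_intCast (algebraMap ℚ L) f.leadingCoeff, ← map_pow, ← map_mul, ← hz]
  simp

lemma exp_ne_neg_one (ι : L →ₐ[ℚ] ℂ) (y : L) : Complex.exp (ι y) ≠ -1 := by
  intro hy
  obtain ⟨f, hf0, hf⟩ := exists_int_polynomial y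
  obtain ⟨k, hk, hsum⟩ := sum_exp ι y hy
  obtain ⟨c, hc⟩ := LindemannWeierstrass.exp_polynomial_approx f hf0
  have hfne : f ≠ 0 := by
    rintro rfl
    simp at hf0
  set b := f.leadingCoeff with hb
  have hb0 : b ≠ 0 := leadingCoeff_ne_zero.2 hfne
  set d := f.natDegree with hd
  set C : ℝ := c * |(b : ℝ)| ^ d with hC
  have hroot (S) (hS : S ∈ nonvanishing y) : ι (conjSum y S) ∈ f.aroots ℂ := by
    refine mem_aroots.2 ⟨hfne, ?_⟩
    have := congrArg (ι.restrictScalars ℤ) (hf S hS)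
    rwa [← aeval_algHom_apply, map_zero] at this
  have hlim := (FloorSemiring.tendsto_pow_div_factorial_atTop C).const_mul
    ((nonvanishing y).card * C)
  rw [mul_zero] at hlim
  obtain ⟨q₀, hq₀⟩ := Filter.eventually_atTop.1 (hlim.eventually_lt_const one_pos)
  obtain ⟨p, hpge, hp⟩ := Nat.exists_infinite_primes
    (q₀ + (f.eval 0).natAbs + k + b.natAbs + 1)
  obtain ⟨n, hn, g, hg, happ⟩ := hc p (by omega) hp
  obtain ⟨z, hz⟩ := exists_int_sum hf (hg.trans (Nat.sub_le _ _))
  have hz' : (z : ℂ) = (b : ℂ) ^ (p * d) * ∑ S ∈ nonvanishing y, aeval (ι (conjSum y S)) g := by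
    have := congrArg ι hz
    rw [map_mul, map_pow, map_intCast, map_intCast, map_sum] at this
    rw [this]
    congr 1
    exact Finset.sum_congr rfl fun S _ =>
      (aeval_algHom_apply (ι.restrictScalars ℤ) (conjSum y S) g).symm
  have hid : ((-(n * k * b ^ (p * d)) - p * z : ℤ) : ℂ) = (b : ℂ) ^ (p * d) *
      ∑ S ∈ nonvanishing y, (n • Complex.exp (ι (conjSum y S))
        - p • aeval (ι (conjSum y S)) g) := by
    rw [Finset.sum_sub_distrib, ← Finset.smul_sum, ← Finset.smul_sum, hsum]
    push_cast
    rw [hz', zsmul_eq_mul, nsmul_eq_mul]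
    ring
  have hbound : ‖((-(n * k * b ^ (p * d)) - p * z : ℤ) : ℂ)‖ < 1 := by
    obtain ⟨q, rfl⟩ : ∃ q, p = q + 1 := ⟨p - 1, by omega⟩
    refine lt_of_le_of_lt ?_ (hq₀ q (by omega))
    rw [hid, norm_mul, norm_pow, Complex.norm_intCast]
    calc |(b : ℝ)| ^ ((q + 1) * d) * ‖∑ S ∈ nonvanishing y, (n • Complex.exp (ι (conjSum y S))
            - (q + 1) • aeval (ι (conjSum y S)) g)‖
        ≤ |(b : ℝ)| ^ ((q + 1) * d) * ((nonvanishing y).card • (c ^ (q + 1) / (q.factorial : ℝ))) := by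
          gcongr
          exact norm_sum_le_of_le _ (fun S hS => happ (hroot S hS)) |>.trans_eq (by simp)
      _ = (nonvanishing y).card * C * (C ^ q / q.factorial) := by
          rw [hC, nsmul_eq_mul, mul_pow, ← pow_mul]
          ring
  rw [Complex.norm_intCast] at hbound
  have hzero : -(n * k * b ^ (p * d)) - p * z = 0 := Int.abs_lt_one_iff.1 (by exact_mod_cast hbound)
  have hpp : Prime (p : ℤ) := Nat.prime_iff_prime_int.1 hp
  have hdvd : (p : ℤ) ∣ n * k * b ^ (p * d) := ⟨-z, by linarith⟩
  have hlt {m : ℕ} (h0 : 0 < m) (h : m < p) : ¬ p ∣ m := fun h' => by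
    have := Nat.le_of_dvd h0 h'
    omega
  rcases hpp.dvd_or_dvd hdvd with h | h
  · rcases hpp.dvd_or_dvd h with h | h
    · exact hn h
    · exact hlt hk (by omega) (Int.natCast_dvd_natCast.1 h)
  · exact hlt (Int.natAbs_pos.2 hb0) (by omega) (Int.natCast_dvd.1 (hpp.dvd_of_dvd_pow h))

end

lemma exists_isGalois {F E : Type*} [Field F] [CharZero F] [Field E] [IsAlgClosed E] [Algebra F E]
    {x : E} (hx : IsAlgebraic F x) :
    ∃ L : IntermediateField F E, x ∈ L ∧ FiniteDimensional F L ∧ IsGalois F L := by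
  have h : (minpoly F x).IsSplittingField F
      (IntermediateField.adjoin F ((minpoly F x).rootSet E)) :=
    IntermediateField.adjoin_rootSet_isSplittingField (IsAlgClosed.splits _)
  refine ⟨_, IntermediateField.subset_adjoin F _
    (mem_rootSet.2 ⟨minpoly.ne_zero hx.isIntegral, minpoly.aeval F x⟩),
    h.finiteDimensional, ?_⟩
  exact IsGalois.of_separable_splitting_field (minpoly.irreducible hx.isIntegral).separable

theorem transcendental_pi : Transcendental ℚ Real.pi := by
  intro hπ
  have hI : IsAlgebraic ℚ Complex.I := by
    refine ⟨X ^ 2 + 1, fun h => ?_, by simp⟩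
    simpa using congrArg (eval 0) h
  obtain ⟨L, hxL, _, _⟩ := exists_isGalois ((hπ.algebraMap (A := ℂ)).mul hI)
  exact exp_ne_neg_one L.val ⟨_, hxL⟩ Complex.exp_pi_mul_I

end PiTranscendental

namespace MZV

/-- Strictly decreasing `1`-tuples of positive integers are positive integers. -/
def singletonEquiv :
    {n : Fin 1 → ℕ // StrictAnti n ∧ ∀ i, 0 < n i} ≃ ℕ+ where
  toFun n := ⟨n.1 0, n.2.2 0⟩
  invFun m := ⟨fun _ => m, Subsingleton.strictAnti _, fun _ => m.2⟩
  left_inv n := Subtype.ext (funext fun i => by rw [Subsingleton.elim i 0]; rfl)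
  right_inv _ := rfl

/-- Strictly decreasing `2`-tuples of positive integers are pairs of positive integers. -/
def pairEquiv :
    {n : Fin 2 → ℕ // StrictAnti n ∧ ∀ i, 0 < n i} ≃ {p : ℕ+ × ℕ+ | p.2 < p.1} where
  toFun n := ⟨(⟨n.1 0, n.2.2 0⟩, ⟨n.1 1, n.2.2 1⟩), n.2.1 Fin.zero_lt_one⟩
  invFun p := ⟨![p.1.1, p.1.2], by
    refine ⟨?_, fun i => ?_⟩
    · rw [Fin.strictAnti_iff_succ_lt]
      intro i
      fin_cases i
      exact p.2
    · fin_cases i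
      exacts [p.1.1.2, p.1.2.2]⟩
  left_inv n := Subtype.ext (funext fun i => by fin_cases i <;> rfl)
  right_inv _ := rfl

lemma mzv_singleton (a : ℕ) : mzv [a] = ∑' n : ℕ+, 1 / (n : ℝ) ^ a := by
  rw [← singletonEquiv.tsum_eq]
  exact tsum_congr fun n => Fin.prod_univ_one _

lemma mzv_pair (a b : ℕ) : mzv [a, b] = ∑' p : ℕ+ × ℕ+, {p : ℕ+ × ℕ+ | p.2 < p.1}.indicator
    (fun p => 1 / (p.1 : ℝ) ^ a * (1 / (p.2 : ℝ) ^ b)) p := by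
  rw [← tsum_subtype, ← pairEquiv.tsum_eq]
  exact tsum_congr fun n => Fin.prod_univ_two _

lemma summable_pnat {a : ℕ} (ha : 2 ≤ a) : Summable fun n : ℕ+ => 1 / (n : ℝ) ^ a :=
  (Real.summable_one_div_nat_pow.2 ha).comp_injective PNat.coe_injective

/-- The stuffle product of two depth one zeta values. -/
lemma mzv_mul_mzv {a b : ℕ} (ha : 2 ≤ a) (hb : 2 ≤ b) :
    mzv [a] * mzv [b] = mzv [a, b] + mzv [b, a] + mzv [a + b] := by
  set f : ℕ+ × ℕ+ → ℝ := fun p => 1 / (p.1 : ℝ) ^ a * (1 / (p.2 : ℝ) ^ b) with hf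
  have hs : Summable f := (summable_pnat ha).mul_of_nonneg (summable_pnat hb)
    (fun _ => by positivity) (fun _ => by positivity)
  have hprod : mzv [a] * mzv [b] = ∑' p, f p := by
    rw [mzv_singleton, mzv_singleton]
    exact tsum_mul_tsum_of_summable_norm (summable_pnat ha).norm (summable_pnat hb).norm
  have h1 : mzv [b, a] = ∑' p, {p : ℕ+ × ℕ+ | p.1 < p.2}.indicator f p := by
    rw [mzv_pair, ← (Equiv.prodComm _ _).tsum_eq]
    refine tsum_congr fun p => ?_
    simp only [Set.indicator_apply, Set.mem_ofPred_eq, Equiv.prodComm_apply, Prod.fst_swap,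
      Prod.snd_swap, hf, mul_comm]
  have h2 : mzv [a + b] = ∑' p, {p : ℕ+ × ℕ+ | p.1 = p.2}.indicator f p := by
    let e : ℕ+ ≃ {p : ℕ+ × ℕ+ | p.1 = p.2} :=
      { toFun := fun n => ⟨(n, n), rfl⟩
        invFun := fun p => p.1.1
        left_inv := fun _ => rfl
        right_inv := fun p => Subtype.ext (Prod.ext rfl p.2) }
    rw [mzv_singleton, ← tsum_subtype, ← e.tsum_eq]
    exact tsum_congr fun n => by simp [e, hf, pow_add, mul_comm]
  rw [hprod, mzv_pair, h1, h2, ← (hs.indicator _).tsum_add (hs.indicator _),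
    ← ((hs.indicator _).add (hs.indicator _)).tsum_add (hs.indicator _)]
  refine tsum_congr fun p => ?_
  rcases lt_trichotomy p.1 p.2 with h | h | h
  · simp [h, h.ne, h.not_gt]
  · simp [h]
  · simp [h, h.ne', h.not_gt]

lemma mzv_singleton_pos {a : ℕ} (ha : 2 ≤ a) : 0 < mzv [a] := by
  rw [mzv_singleton]
  exact (summable_pnat ha).tsum_pos (fun _ => by positivity) 1 (by simp)

lemma irrational_mzv_three : Irrational (mzv [3]) := by
  refine Apery.irrational_of_hasSum ?_
  rw [mzv_singleton, tsum_pnat_eq_tsum_succ (f := fun n : ℕ => 1 / (n : ℝ) ^ 3)]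
  have := ((summable_nat_add_iff 1).2
    (Real.summable_one_div_nat_pow.2 (by norm_num : 1 < 3))).hasSum
  simpa using this

/-- Euler: `ζ(2j)` is a nonzero rational multiple of `π ^ (2j)`. -/
lemma exists_mzv_two_mul {j : ℕ} (hj : j ≠ 0) :
    ∃ r : ℚ, r ≠ 0 ∧ mzv [2 * j] = r * Real.pi ^ (2 * j) := by
  have h2 : 2 ≤ 2 * j := by omega
  have h : mzv [2 * j] = ((((-1) ^ (j + 1) * 2 ^ (2 * j - 1) * bernoulli (2 * j) /
      (2 * j).factorial : ℚ)) : ℝ) * Real.pi ^ (2 * j) := by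
    have hz := hasSum_zeta_nat hj
    have h0 := tsum_zero_pnat_eq_tsum_nat hz.summable
    rw [hz.tsum_eq, Nat.cast_zero, zero_pow (by omega), div_zero, zero_add] at h0
    rw [mzv_singleton, h0]
    push_cast
    ring
  refine ⟨_, fun h0 => (mzv_singleton_pos h2).ne' ?_, h⟩
  rw [h, h0, Rat.cast_zero, zero_mul]

lemma mzv_mul_mzv_mem_span {M : ℕ → Set (List ℕ)}
    (hM : ∀ w, 2 ≤ w → ∀ s, IsComposition s → s.sum = w →
      mzv s ∈ Submodule.span ℚ (mzv '' M w)) {a b : ℕ} (ha : 2 ≤ a) (hb : 2 ≤ b) :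
    mzv [a] * mzv [b] ∈ Submodule.span ℚ (mzv '' M (a + b)) := by
  rw [mzv_mul_mzv ha hb]
  refine add_mem (add_mem ?_ ?_) ?_ <;>
    refine hM _ (by omega) _ ⟨by simp, by simp; omega, by simp; omega⟩ (by simp [add_comm])

lemma linearIndependent_pow {F E : Type*} [Field F] [Field E] [Algebra F E] {x : E}
    (hx : Transcendental F x) : LinearIndependent F fun n : ℕ => x ^ n := by
  have := (Polynomial.basisMonomials F).linearIndependent.map'
    (Polynomial.aeval x).toLinearMap (LinearMap.ker_eq_bot.2 (transcendental_iff_injective.1 hx))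
  have e : (fun n : ℕ => x ^ n) =
      (Polynomial.aeval x).toLinearMap ∘ Polynomial.basisMonomials F := by
    ext n
    simp
  rwa [e]

section Exchange
variable {ι K V : Type*} [DecidableEq ι] [DivisionRing K] [AddCommGroup V] [Module K V]

lemma exists_update {v : ι → V} (hv : LinearIndependent K v) {i : ι} {S : Set V}
    (h : v i ∈ Submodule.span K S) :
    ∃ s ∈ S, LinearIndependent K (Function.update v i s) := by
  by_contra! hS
  refine hv.notMem_span_image (s := {i}ᶜ) (x := i) (by simp) (Submodule.span_le.2 (fun s hs => ?_) h)
  by_contra hs'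
  have heq : Set.EqOn v (Function.update v i s) {i}ᶜ := fun j hj =>
    (Function.update_of_ne hj _ _).symm
  refine hS s hs (linearIndepOn_univ_iff.1 ?_)
  rw [← Set.union_compl_self {i}, Set.singleton_union, linearIndepOn_insert (by simp)]
  refine ⟨(hv.linearIndepOn _).congr heq, ?_⟩
  rwa [← heq.image_eq, Function.update_self]

/-- Steinitz exchange, with one spanning set for each exchanged vector. -/
lemma exists_exchange {v : ι → V} (hv : LinearIndependent K v) {S : ι → Set V} (A : Finset ι)
    (h : ∀ i ∈ A, v i ∈ Submodule.span K (S i)) :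
    ∃ w : ι → V, LinearIndependent K w ∧ (∀ i ∈ A, w i ∈ S i) ∧ ∀ i ∉ A, w i = v i := by
  induction A using Finset.induction_on with
  | empty => exact ⟨v, hv, by simp, by simp⟩
  | insert a A ha ih =>
    obtain ⟨w, hw, hwA, hwv⟩ := ih fun i hi => h i (Finset.mem_insert_of_mem hi)
    obtain ⟨s, hs, hw'⟩ := exists_update hw (i := a) (S := S a)
      (by rw [hwv a ha]; exact h a (Finset.mem_insert_self a A))
    refine ⟨_, hw', fun i hi => ?_, fun i hi => ?_⟩
    · rcases eq_or_ne i a with rfl | hia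
      · rwa [Function.update_self]
      · rw [Function.update_of_ne hia]
        exact hwA i ((Finset.mem_insert.1 hi).resolve_left hia)
    · rw [Finset.mem_insert, not_or] at hi
      rw [Function.update_of_ne hi.1, hwv i hi.2]

end Exchange

/-- If `x` is not in the line spanned by `v 0`, then some other vector can be removed so that `x`
is not in the span of the remaining ones. -/
lemma exists_notMem_span {K V : Type*} [DivisionRing K] [AddCommGroup V] [Module K V]
    {v : ℕ → V} (hv : LinearIndependent K v) {x : V} (hx : ∀ c : K, c • v 0 ≠ x) (l : ℕ) :
    ∃ j ∈ Finset.Icc 1 (l + 1), x ∉ Submodule.span K (v '' {i | i ≤ l + 1 ∧ i ≠ j}) := by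
  by_contra! h
  simp only [Finsupp.mem_span_image_iff_linearCombination] at h
  obtain ⟨c, hc, hcx⟩ := h 1 (by simp)
  have hc0 : c.support ⊆ {0} := fun j hj => by
    rw [Finset.mem_singleton]
    by_contra hj0
    obtain ⟨c', hc', hcx'⟩ := h j (Finset.mem_Icc.2 ⟨by omega, (hc hj).1⟩)
    rw [hv (hcx'.trans hcx.symm)] at hc'
    exact (hc' hj).2 rfl
  refine hx (c 0) ?_
  rw [← hcx, Finsupp.linearCombination_apply, Finsupp.sum_of_support_subset _ hc0 _ (by simp)]
  simp

/-- The products `ζ(2j) ζ(3)`, together with `ζ(3)` itself, are linearly independent. -/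
lemma exists_linearIndependent_mzv_mul_mzv_three :
    ∃ v : ℕ → ℝ, LinearIndependent ℚ v ∧ v 0 = mzv [3] ∧
      ∀ j ≠ 0, v j = mzv [2 * j] * mzv [3] := by
  have hr (j : ℕ) : ∃ r : ℚˣ, (j = 0 → r = 1) ∧
      (j ≠ 0 → mzv [2 * j] = (r : ℚ) * Real.pi ^ (2 * j)) := by
    rcases eq_or_ne j 0 with rfl | hj
    · exact ⟨1, by simp⟩
    · obtain ⟨r, hr, h⟩ := exists_mzv_two_mul hj
      exact ⟨Units.mk0 r hr, by simp [hj, h]⟩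
  choose r hr0 hr using hr
  refine ⟨fun j => (r j : ℚ) * Real.pi ^ (2 * j) * mzv [3], ?_, by simp [hr0 0 rfl],
    fun j hj => by rw [hr j hj]⟩
  have h := (((linearIndependent_pow PiTranscendental.transcendental_pi).comp (fun j => 2 * j)
    (mul_right_injective₀ two_ne_zero)).units_smul r).map' (LinearMap.mulRight ℚ (mzv [3]))
    (LinearMap.ker_eq_bot.2 (mul_left_injective₀ (mzv_singleton_pos (by norm_num)).ne'))
  have e : (fun j => ((r j : ℚ) : ℝ) * Real.pi ^ (2 * j) * mzv [3]) =
      LinearMap.mulRight ℚ (mzv [3]) ∘ (r • (fun n => Real.pi ^ n) ∘ fun j => 2 * j) := by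
    ext j
    simp [Units.smul_def, Rat.smul_def]
  rw [e]
  exact h

end MZV

/-- If for each `w ≥ 2` every multiple zeta value of weight `w` is a rational linear
combination of the values over `M w` (a set of compositions of weight `w`), then for any
`l ≥ 1` there are `l` odd numbers in `{5, 7, …, 2l+5}` and vectors `t i ∈ M i` such that
`1`, `ζ(3)` and the corresponding multiple zeta values are linearly independent over `ℚ`. -/
theorem stmt_2 (M : ℕ → Set (List ℕ))
    (hM1 : ∀ w, 2 ≤ w → ∀ s ∈ M w, IsComposition s ∧ s.sum = w)
    (hM2 : ∀ w, 2 ≤ w → ∀ s, IsComposition s → s.sum = w →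
      mzv s ∈ Submodule.span ℚ (mzv '' M w))
    (l : ℕ) (hl : 0 < l) :
    ∃ I : Finset ℕ, (∀ i ∈ I, Odd i ∧ 5 ≤ i ∧ i ≤ 2 * l + 5) ∧ I.card = l ∧
      ∃ t : ℕ → List ℕ, (∀ i ∈ I, t i ∈ M i) ∧
        LinearIndependent ℚ
          (Sum.elim ![(1 : ℝ), mzv [3]] (fun i : {x // x ∈ I} => mzv (t i.1))) := by
  obtain ⟨v, hv, hv0, hvj⟩ := MZV.exists_linearIndependent_mzv_mul_mzv_three
  obtain ⟨j₀, hj₀, hspan⟩ := MZV.exists_notMem_span hv (x := 1) (fun c hc => by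
    rw [hv0, Rat.smul_def] at hc
    refine MZV.irrational_mzv_three ⟨c⁻¹, ?_⟩
    rw [Rat.cast_inv]
    exact inv_eq_of_mul_eq_one_right hc) l
  have hind : LinearIndependent ℚ fun o : Option {i | i ≤ l + 1 ∧ i ≠ j₀} =>
      (Option.casesOn' o 1 fun i => v i : ℝ) :=
    LinearIndependent.option (hv.linearIndepOn _) (by rwa [← Set.image_eq_range])
  rw [Finset.mem_Icc] at hj₀
  let I := ((Finset.Icc 1 (l + 1)).erase j₀).image fun j => 2 * j + 3
  have hI {i : ℕ} (hi : i ∈ I) : ∃ j, j ≠ 0 ∧ j ≤ l + 1 ∧ j ≠ j₀ ∧ i = 2 * j + 3 := by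
    obtain ⟨j, hj, rfl⟩ := Finset.mem_image.1 hi
    rw [Finset.mem_erase, Finset.mem_Icc] at hj
    exact ⟨j, by omega, by omega, hj.1, rfl⟩
  choose! q hq0 hql hqj hq using fun i (hi : i ∈ I) => hI hi
  let e : Fin 2 ⊕ {x // x ∈ I} → Option {i | i ≤ l + 1 ∧ i ≠ j₀} :=
    Sum.elim ![none, some ⟨0, by omega, by omega⟩] fun i => some ⟨q i, hql i i.2, hqj i i.2⟩
  have he : Function.Injective e := by
    refine Function.Injective.sumElim ?_ (fun i i' h => ?_) (fun a i => ?_)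
    · intro a a'
      fin_cases a <;> fin_cases a' <;> simp
    · have h' : q i = q i' := by simpa using h
      exact Subtype.ext (by rw [hq i i.2, hq i' i'.2, h'])
    · have := hq0 i i.2
      fin_cases a <;> simp [this.symm]
  obtain ⟨w, hw, hwS, hwv⟩ := MZV.exists_exchange (hind.comp e he)
    (S := Sum.elim (fun _ => ∅) fun i : {x // x ∈ I} => mzv '' M i)
    (Finset.univ.map Function.Embedding.inr) (by
      intro i hi
      obtain ⟨i, -, rfl⟩ := Finset.mem_map.1 hi
      have := MZV.mzv_mul_mzv_mem_span hM2 (a := 2 * q i) (b := 3)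
        (by have := hq0 i i.2; omega) (by norm_num)
      rw [← hq i i.2, ← hvj _ (hq0 i i.2)] at this
      exact this)
  have ht : ∀ i ∈ I, ∃ s ∈ M i, ∃ hi : i ∈ I, mzv s = w (Sum.inr ⟨i, hi⟩) := fun i hi => by
    obtain ⟨s, hs, hsw⟩ := hwS (Sum.inr ⟨i, hi⟩) (by simp)
    exact ⟨s, hs, hi, hsw⟩
  choose! t htM _ htw using ht
  refine ⟨I, fun i hi => ?_, ?_, t, htM, ?_⟩
  · have h0 := hq0 i hi
    have h1 := hql i hi
    have h2 := hq i hi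
    exact ⟨⟨q i + 1, by omega⟩, by omega, by omega⟩
  · rw [Finset.card_image_of_injective _ fun a b h => by simpa using h,
      Finset.card_erase_of_mem (Finset.mem_Icc.2 hj₀), Nat.card_Icc]
    omega
  · have hwt : Sum.elim ![(1 : ℝ), mzv [3]] (fun i : {x // x ∈ I} => mzv (t i.1)) = w := by
      ext x
      rcases x with a | i
      · rw [hwv _ (by simp)]
        fin_cases a <;> simp [e, hv0]
      · exact htw i i.2
    rw [hwt]
    exact hw
end
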